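/- Let M be the minimal catenoid in ℝ³ with its induced metric g. Then for every m > 0 and every regular (smooth) open set Ω ⊂ M with Vol_g(Ω) = m, one has the strict inequality λ₁(Ω) > λ₁(B_m), where B_m is a Euclidean disk in ℝ² of area m. -/

import Mathlib

noncomputable section

open Real Filter Topology

instance : Fact (0 < 2 * Real.pi) := ⟨Real.two_pi_pos⟩

/-- Coordinate model of the minimal catenoid `{x² + y² = λ² cosh²(z/λ)} ⊆ ℝ³`:
the annulus `S¹ × ℝ` in the coordinates `(θ, t)` coming from the arc-length
parameterization of the catenary, in which the induced metric reads
`g = (t² + λ²) dθ² + dt²`. -/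
abbrev Catenoid : Type := AddCircle (2 * Real.pi) × ℝ

/-- the lift of a function on the catenoid to a `2π`-periodic function on `ℝ × ℝ` -/
def catLift (u : Catenoid → ℝ) : ℝ × ℝ → ℝ := fun p => u ((p.1 : AddCircle (2 * Real.pi)), p.2)

/-- a choice of `(θ, t)`-coordinates with `θ ∈ [0, 2π)` for a point of the catenoid -/
def catRep (x : Catenoid) : ℝ × ℝ := ((AddCircle.equivIco (2 * Real.pi) 0 x.1 : ℝ), x.2)

/-- the Riemannian volume measure of the catenoid: `dvol_g = √(t² + λ²) dθ dt` -/
def catVol (lam : ℝ) : MeasureTheory.Measure Catenoid :=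
  (MeasureTheory.volume : MeasureTheory.Measure Catenoid).withDensity
    fun x => ENNReal.ofReal (Real.sqrt (x.2 ^ 2 + lam ^ 2))

/-- the squared norm of the Riemannian gradient on the catenoid:
`‖∇^g u‖_g² = (∂_θ u)²/(t² + λ²) + (∂_t u)²` -/
def catGradSq (lam : ℝ) (u : Catenoid → ℝ) (x : Catenoid) : ℝ :=
  (fderiv ℝ (catLift u) (catRep x) (1, 0)) ^ 2 / (x.2 ^ 2 + lam ^ 2) +
    (fderiv ℝ (catLift u) (catRep x) (0, 1)) ^ 2

/-- smooth functions on the catenoid -/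
def CatSmooth (u : Catenoid → ℝ) : Prop := ContDiff ℝ (⊤ : ℕ∞) (catLift u)

/-- the first Dirichlet eigenvalue `λ₁(Ω)` of the Laplace–Beltrami operator of the
catenoid on `Ω`, as the infimum of the Rayleigh quotient over smooth compactly
supported test functions vanishing outside `Ω` -/
def catLam1 (lam : ℝ) (Ω : Set Catenoid) : ℝ :=
  sInf {c | ∃ u : Catenoid → ℝ, CatSmooth u ∧ HasCompactSupport u ∧ tsupport u ⊆ Ω ∧
    (∫ x, (u x) ^ 2 ∂catVol lam) ≠ 0 ∧
    c = (∫ x, catGradSq lam u x ∂catVol lam) / ∫ x, (u x) ^ 2 ∂catVol lam}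

/-- the first Dirichlet eigenvalue of the Euclidean Laplacian on a planar disk of
area `m` (i.e. of radius `√(m/π)`) -/
def diskLam1 (m : ℝ) : ℝ :=
  sInf {c | ∃ u : EuclideanSpace ℝ (Fin 2) → ℝ, ContDiff ℝ (⊤ : ℕ∞) u ∧ HasCompactSupport u ∧
    tsupport u ⊆ Metric.ball 0 (Real.sqrt (m / Real.pi)) ∧
    (∫ x, (u x) ^ 2) ≠ 0 ∧
    c = (∫ x, ‖fderiv ℝ u x‖ ^ 2) / ∫ x, (u x) ^ 2}

/-! Part A: Bessel-type series -/

section PartA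

open scoped Nat

/-- The Bessel-type series `∑ (-y/4)^n / (n! (n+k)!)`. -/
def bes (k : ℕ) (y : ℝ) : ℝ := ∑' n : ℕ, (-y / 4) ^ n / ((n ! : ℝ) * ((n + k)! : ℝ))

lemma bes_summable (k : ℕ) (y : ℝ) :
    Summable fun n : ℕ => (-y / 4) ^ n / ((n ! : ℝ) * ((n + k)! : ℝ)) := by
  refine Summable.of_norm_bounded (g := fun n : ℕ => |(-y / 4)| ^ n / (n ! : ℝ))
    (Real.summable_pow_div_factorial _) (fun n => ?_)
  rw [norm_div, norm_pow, Real.norm_eq_abs, Real.norm_eq_abs]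
  have h1 : (1 : ℝ) ≤ ((n + k)! : ℝ) := by exact_mod_cast Nat.succ_le_of_lt (Nat.factorial_pos _)
  have h2 : (0 : ℝ) < (n ! : ℝ) := by exact_mod_cast Nat.factorial_pos _
  rw [abs_of_pos (show (0 : ℝ) < (n ! : ℝ) * ((n + k)! : ℝ) by positivity)]
  gcongr
  nlinarith

lemma bes_hasDerivAt (k : ℕ) (y : ℝ) : HasDerivAt (bes k) (-(1 / 4) * bes (k + 1) y) y := by
  set ρ : ℝ := |y| + 1 with hρ
  have hρ0 : 0 < ρ := by positivity
  have hsum : Summable fun n : ℕ => (n : ℝ) * (ρ / 4) ^ (n - 1) / (n ! : ℝ) := by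
    rw [← summable_nat_add_iff 1]
    refine (Real.summable_pow_div_factorial (ρ / 4)).congr (fun n => ?_)
    rw [Nat.factorial_succ]
    push_cast
    have : (n ! : ℝ) ≠ 0 := by exact_mod_cast Nat.factorial_ne_zero _
    have h' : (n : ℝ) + 1 ≠ 0 := by positivity
    field_simp
  have key := hasDerivAt_tsum_of_isPreconnected (𝕜 := ℝ) (F := ℝ)
    (g := fun n z => (-z / 4) ^ n / ((n ! : ℝ) * ((n + k)! : ℝ)))
    (g' := fun n z => ((n : ℝ) * (-z / 4) ^ (n - 1) * (-1 / 4)) / ((n ! : ℝ) * ((n + k)! : ℝ)))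
    (t := Metric.ball 0 ρ) (y₀ := 0) (y := y) hsum Metric.isOpen_ball
    (convex_ball (0 : ℝ) ρ).isPreconnected
    (fun n z _ => by
      have h1 : HasDerivAt (fun z : ℝ => -z / 4) (-1 / 4) z := (hasDerivAt_id z).neg.div_const 4
      exact (h1.pow n).div_const _)
    (fun n z hz => by
      have hz' : |z| < ρ := by simpa using hz
      have h1 : (1 : ℝ) ≤ ((n + k)! : ℝ) := by
        exact_mod_cast Nat.succ_le_of_lt (Nat.factorial_pos _)
      have h2 : (0 : ℝ) < (n ! : ℝ) := by exact_mod_cast Nat.factorial_pos _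
      rw [norm_div, norm_mul, norm_mul, norm_pow]
      simp only [Real.norm_eq_abs]
      rw [abs_of_pos (show (0 : ℝ) < (n ! : ℝ) * ((n + k)! : ℝ) by positivity), Nat.abs_cast]
      have h3 : |-z / 4| ≤ ρ / 4 := by
        rw [abs_div, abs_neg, abs_of_pos (show (0 : ℝ) < 4 by norm_num)]
        linarith
      have h4 : |(-1 / 4 : ℝ)| = 1 / 4 := by norm_num [abs_of_neg]
      rw [h4]
      have h5 : |-z / 4| ^ (n - 1) ≤ (ρ / 4) ^ (n - 1) := by gcongr
      have h6 : (0 : ℝ) ≤ (ρ / 4) ^ (n - 1) := by positivity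
      have h7 : (0 : ℝ) ≤ |-z / 4| ^ (n - 1) := by positivity
      have : (n : ℝ) * |-z / 4| ^ (n - 1) * (1 / 4) ≤ (n : ℝ) * (ρ / 4) ^ (n - 1) := by
        have : (n : ℝ) * |-z / 4| ^ (n - 1) ≤ (n : ℝ) * (ρ / 4) ^ (n - 1) := by gcongr
        have : 0 ≤ (n : ℝ) * |-z / 4| ^ (n - 1) := by positivity
        linarith
      exact div_le_div₀ (by positivity) this h2 (by nlinarith))
    (by simpa using hρ0) (bes_summable k 0) (by simp [hρ])
  refine HasDerivAt.congr_deriv key (Eq.symm ?_)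
  have hs : Summable fun n : ℕ =>
      ((n : ℝ) * (-y / 4) ^ (n - 1) * (-1 / 4)) / ((n ! : ℝ) * ((n + k)! : ℝ)) := by
    rw [← summable_nat_add_iff 1]
    refine ((bes_summable (k + 1) y).mul_left (-(1 / 4))).congr (fun n => ?_)
    rw [Nat.factorial_succ, show n + 1 + k = n + (k + 1) by ring]
    have : (n ! : ℝ) ≠ 0 := by exact_mod_cast Nat.factorial_ne_zero _
    have : ((n + (k + 1))! : ℝ) ≠ 0 := by exact_mod_cast Nat.factorial_ne_zero _
    have h' : (n : ℝ) + 1 ≠ 0 := by positivity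
    simp only [Nat.add_sub_cancel]
    push_cast
    field_simp
  rw [hs.tsum_eq_zero_add, bes, ← tsum_mul_left]
  simp only [CharP.cast_eq_zero, zero_mul, zero_div, zero_add]
  refine tsum_congr (fun n => ?_)
  rw [Nat.factorial_succ, show n + 1 + k = n + (k + 1) by ring]
  have : (n ! : ℝ) ≠ 0 := by exact_mod_cast Nat.factorial_ne_zero _
  have : ((n + (k + 1))! : ℝ) ≠ 0 := by exact_mod_cast Nat.factorial_ne_zero _
  have h' : (n : ℝ) + 1 ≠ 0 := by positivity
  simp only [Nat.add_sub_cancel]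
  push_cast
  field_simp

lemma bes_contDiff_nat (j : ℕ) : ∀ k, ContDiff ℝ j (bes k) := by
  induction j with
  | zero =>
    intro k
    exact contDiff_zero.2 (continuous_iff_continuousAt.2 fun y => (bes_hasDerivAt k y).continuousAt)
  | succ j ih =>
    intro k
    have : ((j + 1 : ℕ) : WithTop ℕ∞) = (j : WithTop ℕ∞) + 1 := by norm_cast
    rw [this, contDiff_succ_iff_deriv]
    refine ⟨fun y => (bes_hasDerivAt k y).differentiableAt, by simp, ?_⟩
    have : deriv (bes k) = fun y => -(1 / 4) * bes (k + 1) y :=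
      funext fun y => (bes_hasDerivAt k y).deriv
    rw [this]
    exact contDiff_const.mul (ih (k + 1))

lemma bes_contDiff (k : ℕ) : ContDiff ℝ (⊤ : ℕ∞) (bes k) :=
  contDiff_infty.2 fun j => bes_contDiff_nat j k

lemma bes_continuous (k : ℕ) : Continuous (bes k) := (bes_contDiff k).continuous

lemma bes_zero (k : ℕ) : bes k 0 = 1 / (k ! : ℝ) := by
  rw [bes, tsum_eq_single 0]
  · simp
  · intro n hn
    simp [hn]

/-- the three term recurrence in the only case we need -/
lemma bes_rec (y : ℝ) : y / 4 * bes 2 y = bes 1 y - bes 0 y := by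
  have h : bes 0 y - bes 1 y = ∑' n : ℕ, (n : ℝ) * (-y / 4) ^ n / ((n ! : ℝ) * ((n + 1)! : ℝ)) := by
    rw [bes, bes, ← (bes_summable 0 y).tsum_sub (bes_summable 1 y)]
    refine tsum_congr (fun n => ?_)
    rw [Nat.add_zero, Nat.factorial_succ]
    have : (n ! : ℝ) ≠ 0 := by exact_mod_cast Nat.factorial_ne_zero _
    have h' : (n : ℝ) + 1 ≠ 0 := by positivity
    push_cast
    field_simp
    ring
  have hterm : ∀ n : ℕ, ((n + 1 : ℕ) : ℝ) * (-y / 4) ^ (n + 1) / (((n + 1)! : ℝ) * ((n + 1 + 1)! : ℝ))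
      = (-y / 4) * ((-y / 4) ^ n / ((n ! : ℝ) * ((n + 2)! : ℝ))) := by
    intro n
    rw [show n + 1 + 1 = n + 2 by ring, Nat.factorial_succ n]
    have : (n ! : ℝ) ≠ 0 := by exact_mod_cast Nat.factorial_ne_zero _
    have : ((n + 2)! : ℝ) ≠ 0 := by exact_mod_cast Nat.factorial_ne_zero _
    have h' : (n : ℝ) + 1 ≠ 0 := by positivity
    push_cast
    field_simp
    ring
  have hs : Summable fun n : ℕ => (n : ℝ) * (-y / 4) ^ n / ((n ! : ℝ) * ((n + 1)! : ℝ)) := by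
    rw [← summable_nat_add_iff 1]
    exact ((bes_summable 2 y).mul_left (-y / 4)).congr (fun n => (hterm n).symm)
  rw [hs.tsum_eq_zero_add] at h
  simp only [hterm] at h
  rw [tsum_mul_left, ← bes] at h
  simp at h
  linarith

/-- derivative of `y * b₁` -/
lemma bes_yb1_hasDerivAt (y : ℝ) : HasDerivAt (fun y => y * bes 1 y) (bes 0 y) y := by
  refine ((hasDerivAt_id y).mul (bes_hasDerivAt 1 y)).congr_deriv ?_
  have := bes_rec y
  simp
  linarith

/-- there is a first zero of `b₀`. -/
lemma bes_exists_zero : ∃ y0 : ℝ, 0 < y0 ∧ bes 0 y0 = 0 ∧ ∀ y, 0 ≤ y → y < y0 → 0 < bes 0 y := by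
  have h0 : bes 0 0 = 1 := by simp [bes_zero]
  have hex : ∃ y, 0 ≤ y ∧ bes 0 y ≤ 0 := by
    by_contra! hcon
    -- y b1 increasing on [0,∞)
    have hmono : StrictMonoOn (fun y => y * bes 1 y) (Set.Ici 0) := by
      refine strictMonoOn_of_deriv_pos (convex_Ici 0) ?_ ?_
      · exact (continuous_id.mul (bes_continuous 1)).continuousOn
      · intro x hx
        rw [interior_Ici] at hx
        rw [(bes_yb1_hasDerivAt x).deriv]
        exact hcon x (le_of_lt hx)
    set c := (1 : ℝ) * bes 1 1 with hc
    have hc0 : 0 < c := by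
      have := hmono (Set.mem_Ici.2 le_rfl) (Set.mem_Ici.2 zero_le_one) one_pos
      simpa [hc] using this
    -- b0 + (c/4) log is antitone on [1,∞)
    have hanti : AntitoneOn (fun y => bes 0 y + c / 4 * Real.log y) (Set.Ici 1) := by
      refine antitoneOn_of_deriv_nonpos (convex_Ici 1) ?_ ?_ ?_
      · refine (bes_continuous 0).continuousOn.add (continuousOn_const.mul ?_)
        exact Real.continuousOn_log.mono (fun x hx => by
          have : (1 : ℝ) ≤ x := hx
          simp; linarith)
      · intro x hx
        rw [interior_Ici] at hx
        have hx' : (1 : ℝ) < x := hx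
        exact ((bes_hasDerivAt 0 x).add ((Real.hasDerivAt_log (by linarith)).const_mul (c / 4))).differentiableAt.differentiableWithinAt
      · intro x hx
        rw [interior_Ici] at hx
        have hx' : (1 : ℝ) < x := hx
        have hd : HasDerivAt (fun y => bes 0 y + c / 4 * Real.log y) _ x :=
          (bes_hasDerivAt 0 x).add ((Real.hasDerivAt_log (by linarith)).const_mul (c / 4))
        rw [hd.deriv]
        have := hmono (Set.mem_Ici.2 zero_le_one) (Set.mem_Ici.2 (by linarith)) hx'
        have h1 : c < x * bes 1 x := this
        have h2 : c * x⁻¹ < bes 1 x := by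
          rw [← div_eq_mul_inv, div_lt_iff₀ (by linarith)]; linarith
        simp only [zero_add]
        linarith
    have hM : ∃ M : ℝ, 1 ≤ M ∧ bes 0 1 < c / 4 * Real.log M := by
      have := (Real.tendsto_log_atTop.const_mul_atTop (show 0 < c / 4 by positivity))
      exact ((Filter.eventually_ge_atTop 1).and (this.eventually_gt_atTop (bes 0 1))).exists
    obtain ⟨M, hM1, hM2⟩ := hM
    have := hanti (Set.mem_Ici.2 le_rfl) (Set.mem_Ici.2 hM1) hM1
    simp at this
    have := hcon M (by linarith)
    linarith
  obtain ⟨y1, hy1, hy1'⟩ := hex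
  -- the set of nonneg zeros-or-nonpositive points
  set S := {y : ℝ | 0 ≤ y ∧ bes 0 y ≤ 0} with hS
  have hScl : IsClosed S := (isClosed_Ici (a := (0 : ℝ))).inter
    (isClosed_le (bes_continuous 0) continuous_const)
  have hbdd : BddBelow S := ⟨0, fun y hy => hy.1⟩
  have hmem : sInf S ∈ S := hScl.csInf_mem ⟨y1, hy1, hy1'⟩ hbdd
  have hpos : ∀ y, 0 ≤ y → y < sInf S → 0 < bes 0 y := by
    intro y hy hlt
    by_contra! hneg
    exact absurd (csInf_le hbdd (show y ∈ S from ⟨hy, hneg⟩)) (not_le.2 hlt)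
  have h0S : 0 < sInf S := by
    rcases hmem.1.lt_or_eq with h | h
    · exact h
    · have := hmem.2
      rw [← h, h0] at this
      linarith
  refine ⟨sInf S, h0S, ?_, hpos⟩
  refine le_antisymm hmem.2 ?_
  have hcl : sInf S ∈ closure (Set.Iio (sInf S)) := by rw [closure_Iio]; exact Set.self_mem_Iic
  refine le_of_tendsto_of_tendsto (b := nhdsWithin (sInf S) (Set.Iio (sInf S))) tendsto_const_nhds
    ((bes_continuous 0).continuousAt.tendsto.mono_left nhdsWithin_le_nhds) ?_
  filter_upwards [Ioo_mem_nhdsLT h0S] with y hy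
  exact (hpos y hy.1.le hy.2).le

/-- first zero -/
def y0 : ℝ := bes_exists_zero.choose

lemma y0_pos : 0 < y0 := bes_exists_zero.choose_spec.1
lemma bes_y0 : bes 0 y0 = 0 := bes_exists_zero.choose_spec.2.1
lemma bes0_pos {y : ℝ} (h : 0 ≤ y) (h' : y < y0) : 0 < bes 0 y :=
  bes_exists_zero.choose_spec.2.2 y h h'

lemma bes1_nonneg {y : ℝ} (h : 0 ≤ y) (h' : y < y0) : 0 ≤ bes 1 y := by
  rcases h.eq_or_lt with h | h
  · rw [← h, bes_zero]; simp
  have hmono : MonotoneOn (fun y => y * bes 1 y) (Set.Icc 0 y) := by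
    refine monotoneOn_of_deriv_nonneg (convex_Icc 0 y) ?_ ?_ ?_
    · exact (continuous_id.mul (bes_continuous 1)).continuousOn
    · exact fun x _ => (bes_yb1_hasDerivAt x).differentiableAt.differentiableWithinAt
    · intro x hx
      rw [interior_Icc] at hx
      rw [(bes_yb1_hasDerivAt x).deriv]
      exact (bes0_pos hx.1.le (hx.2.trans h')).le
  have := hmono (Set.left_mem_Icc.2 h.le) (Set.right_mem_Icc.2 h.le) h.le
  simp at this
  exact nonneg_of_mul_nonneg_right this h

lemma bes1_le_one {y : ℝ} (h : 0 ≤ y) (h' : y < y0) (h4 : y ≤ 4) : bes 1 y ≤ 2 * bes 0 y ∨ 1 / 4 ≤ y := by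
  by_cases hy : 1 / 4 ≤ y
  · exact Or.inr hy
  left
  push Not at hy
  -- `y² b₂` has derivative `y b₁ ≥ 0`, so `b₂ ≥ 0`, `b₁` is antitone
  have hd2 : ∀ x, HasDerivAt (fun x => x * bes 1 x - x * bes 0 x) (x * bes 1 x / 4) x := by
    intro x
    refine ((bes_yb1_hasDerivAt x).sub ((hasDerivAt_id x).mul (bes_hasDerivAt 0 x))).congr_deriv ?_
    simp
    ring
  have hb10 : ∀ x, 0 < x → x < y0 → bes 0 x ≤ bes 1 x := by
    intro x hx hx'
    have hmono : MonotoneOn (fun x => x * bes 1 x - x * bes 0 x) (Set.Icc 0 x) := by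
      refine monotoneOn_of_deriv_nonneg (convex_Icc 0 x) ?_ ?_ ?_
      · exact ((continuous_id.mul (bes_continuous 1)).sub
          (continuous_id.mul (bes_continuous 0))).continuousOn
      · exact fun z _ => (hd2 z).differentiableAt.differentiableWithinAt
      · intro z hz
        rw [interior_Icc] at hz
        rw [(hd2 z).deriv]
        have := bes1_nonneg hz.1.le (hz.2.trans hx')
        have := hz.1.le
        positivity
    have := hmono (Set.left_mem_Icc.2 hx.le) (Set.right_mem_Icc.2 hx.le) hx.le
    simp at this
    nlinarith
  have hb2 : ∀ x, 0 < x → x < y0 → 0 ≤ bes 2 x := by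
    intro x hx hx'
    have h1 := bes_rec x
    have h2 := hb10 x hx hx'
    have : 0 ≤ x / 4 * bes 2 x := by linarith
    exact nonneg_of_mul_nonneg_right this (by positivity)
  have hanti1 : AntitoneOn (bes 1) (Set.Icc 0 y) := by
    refine antitoneOn_of_deriv_nonpos (convex_Icc 0 y) (bes_continuous 1).continuousOn ?_ ?_
    · exact fun z _ => (bes_hasDerivAt 1 z).differentiableAt.differentiableWithinAt
    · intro z hz
      rw [interior_Icc] at hz
      rw [(bes_hasDerivAt 1 z).deriv]
      have := hb2 z hz.1 (hz.2.trans h')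
      simp only [Nat.reduceAdd]
      linarith
  have hle1 : ∀ z ∈ Set.Icc 0 y, bes 1 z ≤ 1 := by
    intro z hz
    have := hanti1 (Set.left_mem_Icc.2 h) hz hz.1
    rw [bes_zero] at this
    simpa using this
  have hmono0 : MonotoneOn (fun x => bes 0 x + x / 4) (Set.Icc 0 y) := by
    have hd : ∀ x, HasDerivAt (fun x => bes 0 x + x / 4) (-(1 / 4) * bes 1 x + 1 / 4) x :=
      fun x => (bes_hasDerivAt 0 x).add ((hasDerivAt_id x).div_const 4)
    refine monotoneOn_of_deriv_nonneg (convex_Icc 0 y) ?_ ?_ ?_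
    · exact ((bes_continuous 0).add (continuous_id.div_const 4)).continuousOn
    · exact fun z _ => (hd z).differentiableAt.differentiableWithinAt
    · intro z hz
      rw [interior_Icc] at hz
      rw [(hd z).deriv]
      have := hle1 z ⟨hz.1.le, hz.2.le⟩
      linarith
  have h1 := hmono0 (Set.left_mem_Icc.2 h) (Set.right_mem_Icc.2 h) h
  have h2 := hle1 y (Set.right_mem_Icc.2 h)
  simp [bes_zero] at h1
  linarith

/-- the function `Q = -4π y B'/B` -/
def Qf (y : ℝ) : ℝ := π * y * bes 1 y / bes 0 y

/-- `R = Q²/(4π y)` -/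
def Rf (y : ℝ) : ℝ := π / 4 * (y * bes 1 y ^ 2) / bes 0 y ^ 2

lemma Qf_zero : Qf 0 = 0 := by simp [Qf]

lemma Qf_nonneg {y : ℝ} (h : 0 ≤ y) (h' : y < y0) : 0 ≤ Qf y := by
  have := bes1_nonneg h h'
  have := bes0_pos h h'
  unfold Qf
  positivity

lemma Rf_nonneg {y : ℝ} (h : 0 ≤ y) : 0 ≤ Rf y := by
  unfold Rf
  positivity

lemma Qf_sq {y : ℝ} (h : 0 ≤ y) (h' : y < y0) : Qf y ^ 2 = 4 * π * y * Rf y := by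
  have := bes0_pos h h'
  unfold Qf Rf
  field_simp

lemma Qf_hasDerivAt {y : ℝ} (h : 0 ≤ y) (h' : y < y0) : HasDerivAt Qf (π + Rf y) y := by
  have hb := bes0_pos h h'
  have h1 : HasDerivAt Qf _ y := (((bes_yb1_hasDerivAt y).const_mul π).div (bes_hasDerivAt 0 y) hb.ne').congr_of_eventuallyEq
    (Filter.Eventually.of_forall fun z => by simp [Qf]; ring)
  refine h1.congr_deriv (Eq.symm ?_)
  unfold Rf
  field_simp
  ring

lemma Rf_hasDerivAt {y : ℝ} (h : 0 ≤ y) (h' : y < y0) : HasDerivAt Rf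
    (π / 4 * (bes 1 y * (2 * bes 0 y ^ 2 - bes 0 y * bes 1 y + y * bes 1 y ^ 2 / 2)) / bes 0 y ^ 3) y := by
  have hb := bes0_pos h h'
  have h1 : HasDerivAt Rf _ y := (((bes_yb1_hasDerivAt y).mul (bes_hasDerivAt 1 y)).const_mul (π / 4)).div
    ((bes_hasDerivAt 0 y).pow 2) (pow_pos hb 2).ne' |>.congr_of_eventuallyEq
    (Filter.Eventually.of_forall fun z => by simp [Rf]; ring)
  refine h1.congr_deriv (Eq.symm ?_)
  have := bes_rec y
  have h3 : bes (1 + 1) y = bes 2 y := rfl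
  have h4 : y * bes 2 y = 4 * (bes 1 y - bes 0 y) := by linarith
  simp only [h3]
  have h5 : y * bes 1 y * (-(1 / 4) * bes 2 y) = - bes 1 y * (bes 1 y - bes 0 y) := by
    linear_combination (-(1/4) * bes 1 y) * h4
  rw [h5]
  field_simp
  simp
  ring

lemma Rf_mono : MonotoneOn Rf (Set.Ico 0 y0) := by
  refine monotoneOn_of_deriv_nonneg (convex_Ico 0 y0) ?_ ?_ ?_
  · exact fun z hz => (Rf_hasDerivAt hz.1 hz.2).continuousAt.continuousWithinAt
  · intro z hz
    have hz := interior_subset hz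
    exact (Rf_hasDerivAt hz.1 hz.2).differentiableAt.differentiableWithinAt
  · intro z hz
    have hz := interior_subset hz
    rw [(Rf_hasDerivAt hz.1 hz.2).deriv]
    have hb0 := bes0_pos hz.1 hz.2
    have hb1 := bes1_nonneg hz.1 hz.2
    have : 0 ≤ 2 * bes 0 z ^ 2 - bes 0 z * bes 1 z + z * bes 1 z ^ 2 / 2 := by
      have hz0 := hz.1
      by_cases h4 : z ≤ 1 / 4
      · rcases bes1_le_one hz.1 hz.2 (by linarith) with h | h
        · have : 0 ≤ z * bes 1 z ^ 2 / 2 := by positivity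
          nlinarith
        · nlinarith [sq_nonneg (4 * bes 0 z - bes 1 z), sq_nonneg (bes 1 z)]
      · push Not at h4
        nlinarith [sq_nonneg (4 * bes 0 z - bes 1 z), sq_nonneg (bes 1 z)]
    positivity

/-- tangent inequality -/
lemma Qf_tangent {x z : ℝ} (hx : 0 ≤ x) (hxz : x ≤ z) (hz : z < y0) :
    Qf x + (π + Rf x) * (z - x) ≤ Qf z := by
  have hd : ∀ w ∈ Set.Icc x z, HasDerivAt (fun w => Qf w - (π + Rf x) * w) (π + Rf w - (π + Rf x)) w := by
    intro w hw
    have h2 : HasDerivAt (fun w : ℝ => (π + Rf x) * w) (π + Rf x) w := by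
      simpa using (hasDerivAt_id w).const_mul (π + Rf x)
    exact (Qf_hasDerivAt (hx.trans hw.1) (hw.2.trans_lt hz)).sub h2
  have hm : MonotoneOn (fun w => Qf w - (π + Rf x) * w) (Set.Icc x z) := by
    refine monotoneOn_of_deriv_nonneg (convex_Icc x z) ?_ ?_ ?_
    · exact fun w hw => (hd w hw).continuousAt.continuousWithinAt
    · intro w hw
      exact (hd w (interior_subset hw)).differentiableAt.differentiableWithinAt
    · intro w hw
      have hw := interior_subset hw
      rw [(hd w hw).deriv]
      have := Rf_mono ⟨hx, hxz.trans_lt hz⟩ ⟨hx.trans hw.1, hw.2.trans_lt hz⟩ hw.1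
      linarith
  have := hm (Set.left_mem_Icc.2 hxz) (Set.right_mem_Icc.2 hxz) hxz
  simp only at this
  linarith

end PartA

/-! Part B: upper bound for the disk -/

section PartB

open MeasureTheory

lemma radial_integral (Φ : ℝ → ℝ) {μ : ℝ} (hμ : 0 < μ) :
    ∫ x : EuclideanSpace ℝ (Fin 2), Φ (μ * ‖x‖ ^ 2) =
      ((volume : Measure (EuclideanSpace ℝ (Fin 2))).real (Metric.ball 0 1) / μ) *
        ∫ y in Set.Ioi (0 : ℝ), Φ y := by
  rw [integral_fun_norm_addHaar (volume : Measure (EuclideanSpace ℝ (Fin 2)))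
    (fun r => Φ (μ * r ^ 2))]
  simp only [finrank_euclideanSpace, Fintype.card_fin, smul_eq_mul, nsmul_eq_mul, Nat.cast_ofNat]
  have h1 := integral_comp_rpow_Ioi_of_pos (E := ℝ) (g := fun y => Φ (μ * y)) (p := 2) (by norm_num)
  have h2 := integral_comp_mul_left_Ioi (E := ℝ) Φ 0 hμ
  rw [h2] at h1
  simp only [mul_zero, smul_eq_mul] at h1
  have h3 : ∫ x in Set.Ioi (0 : ℝ), 2 * x ^ ((2 : ℝ) - 1) * Φ (μ * x ^ (2 : ℝ))
      = 2 * ∫ y in Set.Ioi (0 : ℝ), y ^ (2 - 1) * Φ (μ * y ^ 2) := by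
    rw [← integral_const_mul]
    refine setIntegral_congr_fun measurableSet_Ioi (fun x hx => ?_)
    have : (2 : ℝ) - 1 = 1 := by norm_num
    simp only [this, Real.rpow_one, Real.rpow_two, Nat.add_one_sub_one, pow_one]
    ring
  rw [h3] at h1
  rw [div_mul_eq_mul_div, mul_div_assoc, div_eq_inv_mul, ← h1]
  ring

/-- smooth truncation profile -/
def Xf (x : ℝ) : ℝ := x * Real.smoothTransition (x - 1)

lemma Xf_contDiff : ContDiff ℝ (⊤ : ℕ∞) Xf :=
  contDiff_id.mul (Real.smoothTransition.contDiff.comp (contDiff_id.sub contDiff_const))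

lemma Xf_of_le {x : ℝ} (h : x ≤ 1) : Xf x = 0 := by
  simp [Xf, Real.smoothTransition.zero_of_nonpos (show x - 1 ≤ 0 by linarith)]

lemma Xf_of_ge {x : ℝ} (h : 2 ≤ x) : Xf x = x := by
  simp [Xf, Real.smoothTransition.one_of_one_le (show 1 ≤ x - 1 by linarith)]

lemma Xf_abs_le (x : ℝ) : |Xf x| ≤ |x| := by
  rw [Xf, abs_mul, abs_of_nonneg (Real.smoothTransition.nonneg _)]
  exact mul_le_of_le_one_right (abs_nonneg _) (Real.smoothTransition.le_one _)

lemma Xf_hasDerivAt (x : ℝ) : HasDerivAt Xf (deriv Xf x) x :=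
  (Xf_contDiff.differentiable (by simp) x).hasDerivAt

lemma Xf_deriv_cont : Continuous (deriv Xf) := Xf_contDiff.continuous_deriv (by simp)

lemma Xf_deriv_lt {x : ℝ} (h : x < 1) : deriv Xf x = 0 := by
  have : Xf =ᶠ[𝓝 x] fun _ => 0 := by
    filter_upwards [Iio_mem_nhds h] with y hy
    exact Xf_of_le (le_of_lt hy)
  rw [this.deriv_eq]; simp

lemma Xf_deriv_gt {x : ℝ} (h : 2 < x) : deriv Xf x = 1 := by
  have : Xf =ᶠ[𝓝 x] id := by
    filter_upwards [Ioi_mem_nhds h] with y hy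
    exact Xf_of_ge (le_of_lt hy)
  rw [this.deriv_eq]; simp

lemma Xf_deriv_bdd : ∃ C, ∀ x, |deriv Xf x| ≤ C := by
  obtain ⟨C, hC⟩ := (isCompact_Icc (a := (0 : ℝ)) (b := 3)).exists_bound_of_continuousOn
    Xf_deriv_cont.continuousOn
  refine ⟨max C 1, fun x => ?_⟩
  by_cases h1 : x < 1
  · rw [Xf_deriv_lt h1]; simp
  by_cases h2 : 2 < x
  · rw [Xf_deriv_gt h2]; simp
  · push Not at h1 h2
    exact (hC x ⟨by linarith, by linarith⟩).trans (le_max_left _ _)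

/-- radial profile of the test functions -/
def gf (δ y : ℝ) : ℝ := if y < y0 then δ * Xf (bes 0 y / δ) else 0

/-- its derivative -/
def gf' (δ y : ℝ) : ℝ := if y < y0 then deriv Xf (bes 0 y / δ) * (-(1 / 4) * bes 1 y) else 0

lemma gf_zero_near {δ : ℝ} (hδ : 0 < δ) : ∃ y1 < y0, 0 < y1 ∧ ∀ y, y1 < y → gf δ y = 0 := by
  have h : ∀ᶠ y in 𝓝 y0, bes 0 y < δ := by
    have := (bes_continuous 0).tendsto y0
    rw [bes_y0] at this
    exact this.eventually_lt_const hδ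
  obtain ⟨a, ha1, ha2⟩ := exists_Ioc_subset_of_mem_nhds h ⟨0, y0_pos⟩
  refine ⟨max a (y0 / 2), max_lt ha1 (by linarith [y0_pos]), lt_max_of_lt_right (by linarith [y0_pos]), fun y hy => ?_⟩
  unfold gf
  split_ifs with hlt
  · have h1 : bes 0 y < δ := ha2 ⟨(le_max_left _ _).trans_lt hy, hlt.le⟩
    rw [Xf_of_le ((div_le_one hδ).2 h1.le), mul_zero]
  · rfl

lemma gf_contDiff {δ : ℝ} (hδ : 0 < δ) : ContDiff ℝ (⊤ : ℕ∞) (gf δ) := by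
  rw [contDiff_iff_contDiffAt]
  intro y
  by_cases h : y < y0
  · have h1 : gf δ =ᶠ[𝓝 y] fun y => δ * Xf (bes 0 y / δ) := by
      filter_upwards [Iio_mem_nhds h] with z hz
      have hz : z < y0 := hz
      simp [gf, hz]
    refine ContDiffAt.congr_of_eventuallyEq ?_ h1
    exact (contDiff_const.mul (Xf_contDiff.comp ((bes_contDiff 0).div_const δ))).contDiffAt
  · obtain ⟨y1, h1, _, h2⟩ := gf_zero_near hδ
    have h1 : gf δ =ᶠ[𝓝 y] fun y => 0 := by
      filter_upwards [Ioi_mem_nhds (h1.trans_le (not_lt.1 h))] with z hz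
      exact h2 z hz
    exact contDiffAt_const.congr_of_eventuallyEq h1

lemma gf_hasDerivAt {δ : ℝ} (hδ : 0 < δ) (y : ℝ) : HasDerivAt (gf δ) (gf' δ y) y := by
  by_cases h : y < y0
  · have h1 : gf δ =ᶠ[𝓝 y] fun y => δ * Xf (bes 0 y / δ) := by
      filter_upwards [Iio_mem_nhds h] with z hz
      have hz : z < y0 := hz
      simp [gf, hz]
    refine HasDerivAt.congr_of_eventuallyEq ?_ h1
    have := ((Xf_hasDerivAt (bes 0 y / δ)).comp y ((bes_hasDerivAt 0 y).div_const δ)).const_mul δ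
    refine this.congr_deriv ?_
    simp only [gf', h, if_true]
    field_simp
  · obtain ⟨y1, h1, _, h2⟩ := gf_zero_near hδ
    have h1 : gf δ =ᶠ[𝓝 y] fun y => 0 := by
      filter_upwards [Ioi_mem_nhds (h1.trans_le (not_lt.1 h))] with z hz
      exact h2 z hz
    simp only [gf', h, if_false]
    exact (hasDerivAt_const y (0 : ℝ)).congr_of_eventuallyEq h1

lemma lim_den : Tendsto (fun n : ℕ => ∫ y in (0 : ℝ)..y0, (gf (1 / ((n : ℝ) + 1)) y) ^ 2) atTop
    (𝓝 (∫ y in (0 : ℝ)..y0, (bes 0 y) ^ 2)) := by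
  have hae : ∀ᵐ x : ℝ, x ≠ y0 := by simp [ae_iff]
  refine intervalIntegral.tendsto_integral_filter_of_dominated_convergence
    (fun y => (bes 0 y) ^ 2) ?_ ?_ ?_ ?_
  · refine Eventually.of_forall fun n => ?_
    exact ((gf_contDiff (by positivity)).continuous.pow 2).aestronglyMeasurable
  · refine Eventually.of_forall fun n => Eventually.of_forall fun y _ => ?_
    rw [Real.norm_eq_abs, abs_pow, ← sq_abs (bes 0 y)]
    have hδ : (0 : ℝ) < 1 / ((n : ℝ) + 1) := by positivity
    have : |gf (1 / ((n : ℝ) + 1)) y| ≤ |bes 0 y| := by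
      unfold gf
      split_ifs
      · rw [abs_mul, abs_of_pos hδ]
        have := Xf_abs_le (bes 0 y / (1 / ((n : ℝ) + 1)))
        rw [abs_div, abs_of_pos hδ, le_div_iff₀ hδ] at this
        linarith
      · simp
    gcongr
  · exact ((bes_continuous 0).pow 2).intervalIntegrable _ _
  · filter_upwards [hae] with y hy hy'
    rw [Set.uIoc_of_le y0_pos.le] at hy'
    have hlt : y < y0 := lt_of_le_of_ne hy'.2 hy
    have hb := bes0_pos hy'.1.le hlt
    refine Tendsto.congr' ?_ tendsto_const_nhds
    have hn : ∀ᶠ n : ℕ in atTop, 2 / bes 0 y ≤ (n : ℝ) :=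
      tendsto_natCast_atTop_atTop.eventually_ge_atTop _
    filter_upwards [hn] with n hn
    rw [div_le_iff₀ hb] at hn
    have hδ : (0 : ℝ) < (n : ℝ) + 1 := by positivity
    simp only [gf, hlt, if_true]
    rw [Xf_of_ge]
    · field_simp
    · rw [div_div_eq_mul_div, div_one]; nlinarith

lemma lim_num : Tendsto (fun n : ℕ => ∫ y in (0 : ℝ)..y0, 4 * y * (gf' (1 / ((n : ℝ) + 1)) y) ^ 2) atTop
    (𝓝 (∫ y in (0 : ℝ)..y0, y * (bes 1 y) ^ 2 / 4)) := by
  have hae : ∀ᵐ x : ℝ, x ≠ y0 := by simp [ae_iff]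
  obtain ⟨C, hC⟩ := Xf_deriv_bdd
  have hC0 : 0 ≤ C := (abs_nonneg _).trans (hC 0)
  refine intervalIntegral.tendsto_integral_filter_of_dominated_convergence
    (fun y => y * (C ^ 2 * (bes 1 y) ^ 2) / 4) ?_ ?_ ?_ ?_
  · refine Eventually.of_forall fun n => ?_
    have hδ : (0 : ℝ) < 1 / ((n : ℝ) + 1) := by positivity
    have : gf' (1 / ((n : ℝ) + 1)) = deriv (gf (1 / ((n : ℝ) + 1))) :=
      funext fun y => (gf_hasDerivAt hδ y).deriv.symm
    rw [this]
    exact ((continuous_const.mul continuous_id).mul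
      (((gf_contDiff hδ).continuous_deriv (by simp)).pow 2)).aestronglyMeasurable
  · refine Eventually.of_forall fun n => Eventually.of_forall fun y hy' => ?_
    rw [Set.uIoc_of_le y0_pos.le] at hy'
    have hy0 := hy'.1.le
    rw [Real.norm_eq_abs, abs_mul, abs_pow, abs_of_nonneg (by linarith : 0 ≤ 4 * y)]
    have hδ : (0 : ℝ) < 1 / ((n : ℝ) + 1) := by positivity
    have : |gf' (1 / ((n : ℝ) + 1)) y| ≤ C * |bes 1 y| / 4 := by
      unfold gf'
      split_ifs
      · rw [abs_mul, abs_mul, abs_neg, abs_of_pos (show (0 : ℝ) < 1 / 4 by norm_num)]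
        have := hC (bes 0 y / (1 / ((n : ℝ) + 1)))
        have h2 := abs_nonneg (bes 1 y)
        nlinarith
      · simp; positivity
    have h3 : |gf' (1 / ((n : ℝ) + 1)) y| ^ 2 ≤ (C * |bes 1 y| / 4) ^ 2 := by gcongr
    rw [div_pow, mul_pow, sq_abs (bes 1 y)] at h3
    nlinarith
  · exact Continuous.intervalIntegrable (by have := bes_continuous 1; fun_prop) _ _
  · filter_upwards [hae] with y hy hy'
    rw [Set.uIoc_of_le y0_pos.le] at hy'
    have hlt : y < y0 := lt_of_le_of_ne hy'.2 hy
    have hb := bes0_pos hy'.1.le hlt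
    refine Tendsto.congr' ?_ tendsto_const_nhds
    have hn : ∀ᶠ n : ℕ in atTop, 2 / bes 0 y ≤ (n : ℝ) :=
      tendsto_natCast_atTop_atTop.eventually_ge_atTop _
    filter_upwards [hn] with n hn
    rw [div_le_iff₀ hb] at hn
    have hδ : (0 : ℝ) < (n : ℝ) + 1 := by positivity
    simp only [gf', hlt, if_true]
    rw [Xf_deriv_gt]
    · ring
    · rw [div_div_eq_mul_div, div_one]; nlinarith

lemma bes_identity : ∫ y in (0 : ℝ)..y0, y * (bes 1 y) ^ 2 / 4 = ∫ y in (0 : ℝ)..y0, (bes 0 y) ^ 2 := by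
  have hd : ∀ y, HasDerivAt (fun y => y * bes 1 y * bes 0 y) ((bes 0 y) ^ 2 - y * (bes 1 y) ^ 2 / 4) y := by
    intro y
    refine ((bes_yb1_hasDerivAt y).mul (bes_hasDerivAt 0 y)).congr_deriv ?_
    simp only [zero_add]
    ring
  have hc0 : Continuous fun y => (bes 0 y) ^ 2 := (bes_continuous 0).pow 2
  have hc1 : Continuous fun y => y * (bes 1 y) ^ 2 / 4 := by have := bes_continuous 1; fun_prop
  have h := intervalIntegral.integral_eq_sub_of_hasDerivAt (a := 0) (b := y0) (fun y _ => hd y)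
    ((hc0.sub hc1).intervalIntegrable _ _)
  rw [intervalIntegral.integral_sub (hc0.intervalIntegrable _ _) (hc1.intervalIntegrable _ _)] at h
  rw [bes_y0] at h
  linarith

lemma den_pos : 0 < ∫ y in (0 : ℝ)..y0, (bes 0 y) ^ 2 := by
  refine intervalIntegral.intervalIntegral_pos_of_pos_on
    (((bes_continuous 0).pow 2).intervalIntegrable _ _) (fun x hx => ?_) y0_pos
  exact pow_pos (bes0_pos hx.1.le hx.2) 2

lemma int_Ioi_eq {F : ℝ → ℝ} (h : ∀ y, y0 ≤ y → F y = 0) :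
    ∫ y in Set.Ioi (0 : ℝ), F y = ∫ y in (0 : ℝ)..y0, F y := by
  rw [intervalIntegral.integral_of_le y0_pos.le]
  refine setIntegral_eq_of_subset_of_forall_sdiff_eq_zero measurableSet_Ioi
    Set.Ioc_subset_Ioi_self (fun x hx => h x ?_)
  have h1 : 0 < x := hx.1
  have h2 := hx.2
  simp only [Set.mem_Ioc, not_and, not_le] at h2
  exact (h2 h1).le

theorem diskLam1_le {m : ℝ} (hm : 0 < m) : diskLam1 m ≤ π * y0 / m := by
  set μ : ℝ := π * y0 / m with hμdef
  have hμ : 0 < μ := by have := y0_pos; positivity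
  have hbdd : BddBelow {c | ∃ u : EuclideanSpace ℝ (Fin 2) → ℝ, ContDiff ℝ (⊤ : ℕ∞) u ∧
      HasCompactSupport u ∧
      tsupport u ⊆ Metric.ball 0 (Real.sqrt (m / Real.pi)) ∧
      (∫ x, (u x) ^ 2) ≠ 0 ∧
      c = (∫ x, ‖fderiv ℝ u x‖ ^ 2) / ∫ x, (u x) ^ 2} := by
    refine ⟨0, ?_⟩
    rintro c ⟨u, _, _, _, _, rfl⟩
    exact div_nonneg (integral_nonneg fun x => by positivity) (integral_nonneg fun x => by positivity)
  set K : ℝ := (volume : Measure (EuclideanSpace ℝ (Fin 2))).real (Metric.ball 0 1) / μ with hK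
  have hK0 : 0 < K := by
    refine div_pos ?_ hμ
    exact ENNReal.toReal_pos (Metric.measure_ball_pos _ _ one_pos).ne' measure_ball_lt_top.ne
  have hlim : Tendsto (fun n : ℕ => μ * (∫ y in (0 : ℝ)..y0, 4 * y * (gf' (1 / ((n : ℝ) + 1)) y) ^ 2) /
      ∫ y in (0 : ℝ)..y0, (gf (1 / ((n : ℝ) + 1)) y) ^ 2) atTop (𝓝 μ) := by
    have := (lim_num.const_mul μ).div lim_den den_pos.ne'
    rwa [bes_identity, mul_div_assoc, div_self den_pos.ne', mul_one] at this
  refine ge_of_tendsto hlim ?_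
  filter_upwards [lim_den.eventually_ne den_pos.ne'] with n hn
  have hδ : (0 : ℝ) < 1 / ((n : ℝ) + 1) := by positivity
  set δ := 1 / ((n : ℝ) + 1) with hδd
  set u : EuclideanSpace ℝ (Fin 2) → ℝ := fun x => gf δ (μ * ‖x‖ ^ 2) with hu
  obtain ⟨y1, hy1, hy1', hzero⟩ := gf_zero_near hδ
  have hcd : ContDiff ℝ (⊤ : ℕ∞) u := (gf_contDiff hδ).comp (contDiff_const.mul (contDiff_norm_sq ℝ))
  have hts : tsupport u ⊆ Metric.closedBall 0 (Real.sqrt (y1 / μ)) := by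
    refine closure_minimal (fun x hx => ?_) Metric.isClosed_closedBall
    rw [mem_closedBall_zero_iff]
    refine Real.le_sqrt_of_sq_le ?_
    rw [le_div_iff₀ hμ]
    by_contra! hcon
    exact hx (hzero _ (by linarith))
  have hfd : ∀ x, ‖fderiv ℝ u x‖ ^ 2 = (fun y => μ * (4 * y * (gf' δ y) ^ 2)) (μ * ‖x‖ ^ 2) := by
    intro x
    have h1 : HasFDerivAt (fun x : EuclideanSpace ℝ (Fin 2) => μ * ‖x‖ ^ 2) _ x :=
      ((hasStrictFDerivAt_norm_sq x).hasFDerivAt).const_mul μ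
    have h2 := (gf_hasDerivAt hδ (μ * ‖x‖ ^ 2)).comp_hasFDerivAt x h1
    have h3 : fderiv ℝ u x = _ := h2.fderiv
    rw [h3, norm_smul, norm_smul, two_smul, ← two_smul ℝ, norm_smul, innerSL_apply_norm]
    simp only [Real.norm_eq_abs, mul_pow, sq_abs]
    ring
  have e1 : ∫ x, ‖fderiv ℝ u x‖ ^ 2 = K * (μ * ∫ y in (0 : ℝ)..y0, 4 * y * (gf' δ y) ^ 2) := by
    simp_rw [hfd]
    rw [radial_integral (fun y => μ * (4 * y * (gf' δ y) ^ 2)) hμ, integral_const_mul, int_Ioi_eq]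
    intro y hy
    simp [gf', not_lt.2 hy]
  have e2 : ∫ x, (u x) ^ 2 = K * ∫ y in (0 : ℝ)..y0, (gf δ y) ^ 2 := by
    rw [hu, radial_integral (fun y => (gf δ y) ^ 2) hμ, int_Ioi_eq]
    intro y hy
    simp [gf, not_lt.2 hy]
  refine csInf_le hbdd ⟨u, hcd, ?_, ?_, ?_, ?_⟩
  · exact (isCompact_closedBall _ _).of_isClosed_subset (isClosed_tsupport u) hts
  · refine hts.trans (Metric.closedBall_subset_ball ?_)
    refine Real.sqrt_lt_sqrt (by positivity) ?_
    rw [hμdef, div_lt_div_iff₀ (by have := y0_pos; positivity) Real.pi_pos]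
    rw [mul_div_assoc, ]
    have := Real.pi_pos
    have h5 : m / π * (π * y0 / m) = y0 := by field_simp
    have : m * (π * (y0 / m)) = π * y0 := by field_simp
    rw [this]
    nlinarith
  · rw [e2]
    exact mul_ne_zero hK0.ne' hn
  · rw [e1, e2, mul_div_mul_left _ _ hK0.ne']

end PartB

/-! Part C: sharp planar isoperimetric inequality for functions -/

section PartC

open MeasureTheory
open scoped ENNReal

lemma ofReal_integral_le {α : Type*} [MeasurableSpace α] {μ : Measure α} {f : α → ℝ}
    (hf : Integrable f μ) :
    ENNReal.ofReal (∫ x, f x ∂μ) ≤ ∫⁻ x, ENNReal.ofReal (f x) ∂μ := by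
  have h1 : ∫ x, f x ∂μ ≤ ∫ x, max (f x) 0 ∂μ :=
    integral_mono hf hf.pos_part (fun x => le_max_left _ _)
  refine (ENNReal.ofReal_le_ofReal h1).trans (le_of_eq ?_)
  rw [ofReal_integral_eq_lintegral_ofReal hf.pos_part (Eventually.of_forall fun x => le_max_right _ _)]
  refine lintegral_congr fun x => ?_
  rcases le_total (f x) 0 with h | h
  · rw [max_eq_right h, ENNReal.ofReal_of_nonpos h, ENNReal.ofReal_zero]
  · rw [max_eq_left h]

lemma angular_integral (a b : ℝ) :
    ∫ φ in (-π)..π, (max (a * Real.cos φ + b * Real.sin φ) 0) ^ 2 = π * (a ^ 2 + b ^ 2) / 2 := by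
  set g : ℝ → ℝ := fun φ => a * Real.cos φ + b * Real.sin φ with hg
  have hgc : Continuous g := by fun_prop
  have hper : Function.Periodic (fun φ => (max (g φ) 0) ^ 2) (2 * π) := by
    intro φ
    simp [hg, Real.cos_add_two_pi, Real.sin_add_two_pi]
  have h1 : ∫ φ in (-π)..π, (max (g φ) 0) ^ 2 = ∫ φ in (-π)..π, (max (-g φ) 0) ^ 2 := by
    have e1 : ∫ φ in (-π)..π, (max (-g φ) 0) ^ 2 = ∫ φ in (-π)..π, (fun φ => (max (g φ) 0) ^ 2) (φ + π) := by
      refine intervalIntegral.integral_congr (fun φ _ => ?_)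
      simp only [hg, Real.cos_add_pi, Real.sin_add_pi]
      congr 2
      ring
    rw [e1, intervalIntegral.integral_comp_add_right (fun φ => (max (g φ) 0) ^ 2) π]
    have := hper.intervalIntegral_add_eq (-π) (-π + π)
    rw [show -π + 2 * π = π by ring, show -π + π + 2 * π = π + π by ring] at this
    exact this
  have hi1 : IntervalIntegrable (fun φ => (max (g φ) 0) ^ 2) volume (-π) π :=
    Continuous.intervalIntegrable (by fun_prop) _ _
  have hi2 : IntervalIntegrable (fun φ => (max (-g φ) 0) ^ 2) volume (-π) π :=
    Continuous.intervalIntegrable (by fun_prop) _ _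
  have h2 : (∫ φ in (-π)..π, (max (g φ) 0) ^ 2) + ∫ φ in (-π)..π, (max (-g φ) 0) ^ 2
      = ∫ φ in (-π)..π, (g φ) ^ 2 := by
    rw [← intervalIntegral.integral_add hi1 hi2]
    refine intervalIntegral.integral_congr (fun φ _ => ?_)
    rcases le_total (g φ) 0 with h | h
    · rw [max_eq_right h, max_eq_left (by linarith)]; ring
    · rw [max_eq_left h, max_eq_right (by linarith)]; ring
  have h3 : ∫ φ in (-π)..π, (g φ) ^ 2 = π * (a ^ 2 + b ^ 2) := by
    have : ∀ φ, (g φ) ^ 2 = a ^ 2 * Real.cos φ ^ 2 + (2 * a * b) * (Real.sin φ * Real.cos φ)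
        + b ^ 2 * Real.sin φ ^ 2 := fun φ => by simp only [hg]; ring
    simp_rw [this]
    rw [intervalIntegral.integral_add, intervalIntegral.integral_add,
      intervalIntegral.integral_const_mul, intervalIntegral.integral_const_mul,
      intervalIntegral.integral_const_mul, integral_cos_sq, integral_sin_sq, integral_sin_mul_cos₁]
    · simp; ring
    all_goals exact Continuous.intervalIntegrable (by fun_prop) _ _
  linarith

lemma inner_lintegral (g : ℝ) {c : ℝ} (hc : 0 < c) :
    ∫⁻ ρ in Set.Ioi (0 : ℝ), ENNReal.ofReal (g - c * ρ) ≤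
      ENNReal.ofReal ((max g 0) ^ 2 * (1 / (2 * c))) := by
  set G := max g 0 with hG
  have hG0 : 0 ≤ G := le_max_right _ _
  have h1 : ∫⁻ ρ in Set.Ioi (0 : ℝ), ENNReal.ofReal (g - c * ρ) ≤
      ∫⁻ ρ in Set.Ioc (0 : ℝ) (G / c), ENNReal.ofReal (G - c * ρ) := by
    rw [← lintegral_indicator measurableSet_Ioi, ← lintegral_indicator measurableSet_Ioc]
    refine lintegral_mono (fun ρ => ?_)
    by_cases h0 : 0 < ρ
    · rw [Set.indicator_of_mem (show ρ ∈ Set.Ioi (0 : ℝ) from h0)]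
      by_cases h2 : ρ ≤ G / c
      · rw [Set.indicator_of_mem (show ρ ∈ Set.Ioc (0 : ℝ) (G / c) from ⟨h0, h2⟩)]
        exact ENNReal.ofReal_le_ofReal (by linarith [le_max_left g 0])
      · rw [ENNReal.ofReal_of_nonpos]
        · exact zero_le
        · push Not at h2
          rw [div_lt_iff₀ hc] at h2
          linarith [le_max_left g 0]
    · rw [Set.indicator_of_notMem (show ρ ∉ Set.Ioi (0 : ℝ) from h0)]
      exact zero_le
  refine h1.trans ?_
  have hGc : 0 ≤ G / c := by positivity
  rw [← ofReal_integral_eq_lintegral_ofReal, ← intervalIntegral.integral_of_le hGc]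
  · have : ∫ ρ in (0 : ℝ)..(G / c), (G - c * ρ) = G ^ 2 * (1 / (2 * c)) := by
      rw [intervalIntegral.integral_sub, intervalIntegral.integral_const_mul, integral_id]
      · simp; field_simp; ring
      all_goals exact Continuous.intervalIntegrable (by fun_prop) _ _
    rw [this]
  · exact (Continuous.integrableOn_Icc (by fun_prop)).mono_set Set.Ioc_subset_Icc_self
  · refine (ae_restrict_iff' measurableSet_Ioc).2 (Eventually.of_forall fun ρ hρ => ?_)
    have := hρ.2
    rw [le_div_iff₀ hc] at this
    simp
    linarith

lemma polar_lintegral (f : ℂ → ℝ≥0∞) (hf : Measurable f) :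
    ∫⁻ z, f z = ∫⁻ φ in Set.Ioo (-π) π, ∫⁻ ρ in Set.Ioi (0 : ℝ),
      ENNReal.ofReal ρ * f (ρ * (Real.cos φ + Real.sin φ * Complex.I)) := by
  rw [← Complex.lintegral_comp_polarCoord_symm]
  have ht : polarCoord.target = Set.Ioi (0 : ℝ) ×ˢ Set.Ioo (-π) π := rfl
  rw [ht, Measure.volume_eq_prod, ← Measure.prod_restrict, lintegral_prod_symm']
  · simp only [Complex.polarCoord_symm_apply, smul_eq_mul]
  · simp only [Complex.polarCoord_symm_apply, smul_eq_mul]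
    refine (ENNReal.measurable_ofReal.comp measurable_fst).mul (hf.comp ?_)
    exact Continuous.measurable (by fun_prop)

lemma kernel_lintegral (a b : ℝ) {c : ℝ} (hc : 0 < c) :
    ∫⁻ z : ℂ, ENNReal.ofReal ((a * z.re + b * z.im) / ‖z‖ ^ 2 - c) ≤
      ENNReal.ofReal (π * (a ^ 2 + b ^ 2) / (4 * c)) := by
  rw [polar_lintegral]
  · calc ∫⁻ φ in Set.Ioo (-π) π, ∫⁻ ρ in Set.Ioi (0 : ℝ), ENNReal.ofReal ρ *
          ENNReal.ofReal ((a * ((ρ : ℂ) * (Real.cos φ + Real.sin φ * Complex.I)).re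
            + b * ((ρ : ℂ) * (Real.cos φ + Real.sin φ * Complex.I)).im) /
            ‖(ρ : ℂ) * (Real.cos φ + Real.sin φ * Complex.I)‖ ^ 2 - c)
        ≤ ∫⁻ φ in Set.Ioo (-π) π,
          ENNReal.ofReal ((max (a * Real.cos φ + b * Real.sin φ) 0) ^ 2 * (1 / (2 * c))) := by
          refine lintegral_mono (fun φ => ?_)
          refine le_trans (le_of_eq ?_) (inner_lintegral (a * Real.cos φ + b * Real.sin φ) hc)
          refine setLIntegral_congr_fun measurableSet_Ioi (fun ρ hρ => ?_)
          have hρ : (0 : ℝ) < ρ := hρ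
          rw [← ENNReal.ofReal_mul hρ.le]
          congr 1
          have hn : ‖(ρ : ℂ) * (Real.cos φ + Real.sin φ * Complex.I)‖ = ρ := by
            have := Complex.norm_polarCoord_symm (ρ, φ)
            rw [Complex.polarCoord_symm_apply] at this
            simpa [abs_of_pos hρ] using this
          rw [hn]
          have h1 : ((ρ : ℂ) * (Real.cos φ + Real.sin φ * Complex.I)).re = ρ * Real.cos φ := by
            simp [Complex.cos_ofReal_re, Complex.sin_ofReal_im]
          have h2 : ((ρ : ℂ) * (Real.cos φ + Real.sin φ * Complex.I)).im = ρ * Real.sin φ := by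
            simp [Complex.cos_ofReal_im, Complex.sin_ofReal_re]
          rw [h1, h2]
          field_simp
      _ = ENNReal.ofReal (π * (a ^ 2 + b ^ 2) / (4 * c)) := by
          rw [← ofReal_integral_eq_lintegral_ofReal, ← integral_Ioc_eq_integral_Ioo,
            ← intervalIntegral.integral_of_le (by linarith [Real.pi_pos]),
            intervalIntegral.integral_mul_const, angular_integral]
          · congr 1
            field_simp
            ring
          · exact (Continuous.integrableOn_Icc (by fun_prop)).mono_set Set.Ioo_subset_Icc_self
          · exact Eventually.of_forall fun φ => by positivity
  · refine ENNReal.measurable_ofReal.comp (Measurable.sub ?_ measurable_const)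
    refine Measurable.div ?_ ?_
    · exact Continuous.measurable (by fun_prop)
    · exact Continuous.measurable (by fun_prop)

lemma bathtub (a b : ℝ) {c : ℝ} (hc : 0 < c) (E : Set ℂ) (y : ℂ) :
    ∫⁻ x in E, ENNReal.ofReal ((a * (x - y).re + b * (x - y).im) / ‖x - y‖ ^ 2) ≤
      ENNReal.ofReal c * volume E + ENNReal.ofReal (π * (a ^ 2 + b ^ 2) / (4 * c)) := by
  calc ∫⁻ x in E, ENNReal.ofReal ((a * (x - y).re + b * (x - y).im) / ‖x - y‖ ^ 2)
      ≤ ∫⁻ x in E, (ENNReal.ofReal c +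
        ENNReal.ofReal ((a * (x - y).re + b * (x - y).im) / ‖x - y‖ ^ 2 - c)) := by
        refine lintegral_mono (fun x => ?_)
        refine le_trans (ENNReal.ofReal_le_ofReal (le_of_eq ?_)) ENNReal.ofReal_add_le
        ring
    _ = ENNReal.ofReal c * volume E +
        ∫⁻ x in E, ENNReal.ofReal ((a * (x - y).re + b * (x - y).im) / ‖x - y‖ ^ 2 - c) := by
        rw [lintegral_add_left measurable_const]
        simp
    _ ≤ _ := by
        gcongr
        refine (setLIntegral_le_lintegral _ _).trans ?_
        rw [lintegral_sub_right_eq_self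
          (fun z : ℂ => ENNReal.ofReal ((a * z.re + b * z.im) / ‖z‖ ^ 2 - c)) y]
        exact kernel_lintegral a b hc

/-- the norm of the gradient in the plane -/
def gradN (V : ℂ → ℝ) (y : ℂ) : ℝ := √((fderiv ℝ V y 1) ^ 2 + (fderiv ℝ V y Complex.I) ^ 2)

lemma fderiv_decomp (L : ℂ →L[ℝ] ℝ) (z : ℂ) : L z = L 1 * z.re + L Complex.I * z.im := by
  have : z = z.re • (1 : ℂ) + z.im • Complex.I := by
    simp [Complex.re_add_im]
  conv_lhs => rw [this]
  rw [map_add, map_smul, map_smul, smul_eq_mul, smul_eq_mul]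
  ring

lemma bathtub_opt (V : ℂ → ℝ) (y : ℂ) (E : Set ℂ) (hE : volume E ≠ ∞) (hE0 : volume E ≠ 0) :
    ∫⁻ x in E, ENNReal.ofReal (fderiv ℝ V y (x - y) / ‖x - y‖ ^ 2) ≤
      ENNReal.ofReal (gradN V y) * ENNReal.ofReal (√(π * volume.real E)) := by
  have hA : 0 < volume.real E := ENNReal.toReal_pos hE0 hE
  set A := volume.real E with hAd
  set a := fderiv ℝ V y 1
  set b := fderiv ℝ V y Complex.I
  have hN0 : 0 ≤ gradN V y := Real.sqrt_nonneg _
  have hN2 : (gradN V y) ^ 2 = a ^ 2 + b ^ 2 := Real.sq_sqrt (by positivity)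
  have hdec : ∀ x, fderiv ℝ V y (x - y) = a * (x - y).re + b * (x - y).im :=
    fun x => fderiv_decomp _ _
  simp_rw [hdec]
  rcases hN0.eq_or_lt with h | h
  · rw [← h] at hN2
    have ha : a = 0 := by nlinarith [sq_nonneg a, sq_nonneg b]
    have hb : b = 0 := by nlinarith [sq_nonneg a, sq_nonneg b]
    simp [ha, hb]
  · set N := gradN V y
    have hc : 0 < N * √(π / A) / 2 := by positivity
    refine (bathtub a b hc E y).trans ?_
    have hv : volume E = ENNReal.ofReal A := (ENNReal.ofReal_toReal hE).symm
    rw [hv, ← ENNReal.ofReal_mul hc.le, ← ENNReal.ofReal_mul hN0, ← ENNReal.ofReal_add (by positivity) (by positivity)]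
    refine ENNReal.ofReal_le_ofReal (le_of_eq ?_)
    rw [← hN2]
    have hs : √(π / A) = √π / √A := Real.sqrt_div Real.pi_pos.le A
    have hs2 : √(π * A) = √π * √A := Real.sqrt_mul Real.pi_pos.le A
    rw [hs, hs2]
    have h1 : √π ^ 2 = π := Real.sq_sqrt Real.pi_pos.le
    have h2 : √A ^ 2 = A := Real.sq_sqrt hA.le
    have h3 : 0 < √π := by positivity
    have h4 : 0 < √A := by positivity
    conv_lhs => rw [← h2]
    nth_rewrite 2 [← h1]
    rw [Real.sqrt_sq h4.le]
    field_simp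
    norm_num

lemma rep_ineq (V : ℂ → ℝ) (hV : ContDiff ℝ 1 V) (hc : HasCompactSupport V) (x : ℂ) :
    ENNReal.ofReal (2 * π) * ENNReal.ofReal (V x) ≤
      ∫⁻ y, ENNReal.ofReal (fderiv ℝ V y (x - y) / ‖x - y‖ ^ 2) := by
  have hfc : Continuous (fderiv ℝ V) := hV.continuous_fderiv (by simp)
  rw [← lintegral_add_right_eq_self (fun y : ℂ => ENNReal.ofReal (fderiv ℝ V y (x - y) / ‖x - y‖ ^ 2)) x,
    polar_lintegral]
  · calc ENNReal.ofReal (2 * π) * ENNReal.ofReal (V x)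
        = ∫⁻ φ in Set.Ioo (-π) π, ENNReal.ofReal (V x) := by
          rw [lintegral_const, Measure.restrict_apply_univ, Real.volume_Ioo, mul_comm]
          congr 2; ring
      _ ≤ _ := by
          refine lintegral_mono (fun φ => ?_)
          set e : ℂ := Real.cos φ + Real.sin φ * Complex.I with he
          have hen : ‖e‖ = 1 := by
            rw [he, Complex.ofReal_cos, Complex.ofReal_sin, ← Complex.exp_mul_I]
            exact Complex.norm_exp_ofReal_mul_I φ
          have h1 : ∫⁻ ρ in Set.Ioi (0 : ℝ), ENNReal.ofReal ρ * ENNReal.ofReal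
              (fderiv ℝ V (ρ * e + x) (x - (ρ * e + x)) / ‖x - (ρ * e + x)‖ ^ 2)
              = ∫⁻ ρ in Set.Ioi (0 : ℝ), ENNReal.ofReal (-(fderiv ℝ V (x + ρ • e) e)) := by
            refine setLIntegral_congr_fun measurableSet_Ioi (fun ρ hρ => ?_)
            have hρ : (0 : ℝ) < ρ := hρ
            rw [← ENNReal.ofReal_mul hρ.le]
            congr 1
            have e1 : x - ((ρ : ℂ) * e + x) = (-ρ) • e := by
              simp
            have e2 : (ρ : ℂ) * e + x = x + ρ • e := by
              simp [add_comm]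
            rw [e1, e2, map_smul, norm_smul, hen, smul_eq_mul, Real.norm_eq_abs, mul_one, sq_abs]
            field_simp
          refine le_trans ?_ (le_of_eq h1.symm)
          -- FTC along the ray
          have hd : ∀ ρ : ℝ, HasDerivAt (fun ρ : ℝ => -V (x + ρ • e)) (-(fderiv ℝ V (x + ρ • e) e)) ρ := by
            intro ρ
            have hl : HasDerivAt (fun ρ : ℝ => x + ρ • e) e ρ := by
              simpa using ((hasDerivAt_id ρ).smul_const e).const_add x
            exact (((hV.differentiable (by simp)) (x + ρ • e)).hasFDerivAt.comp_hasDerivAt ρ hl).neg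
          have hcont : Continuous fun ρ : ℝ => -(fderiv ℝ V (x + ρ • e) e) := by fun_prop
          obtain ⟨M, hM⟩ := hc.isCompact.isBounded.subset_ball 0
          set P := max M 0 + ‖x‖ with hP
          have hP0 : 0 ≤ P := by positivity
          have hVP : V (x + P • e) = 0 := by
            by_contra hne
            have h3 : x + P • e ∈ Metric.ball (0 : ℂ) M := hM (subset_tsupport V hne)
            rw [mem_ball_zero_iff] at h3
            have h4 : ‖P • e‖ ≤ ‖x + P • e‖ + ‖x‖ := by
              have := norm_sub_le (x + P • e) x
              simpa using this
            rw [norm_smul, hen, mul_one, Real.norm_of_nonneg hP0] at h4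
            have := le_max_left M 0
            linarith
          have hftc := intervalIntegral.integral_eq_sub_of_hasDerivAt (a := 0) (b := P)
            (fun ρ _ => hd ρ) (hcont.intervalIntegrable _ _)
          rw [hVP] at hftc
          simp only [neg_zero, zero_smul, add_zero, sub_neg_eq_add, zero_add] at hftc
          rw [← hftc, intervalIntegral.integral_of_le hP0]
          refine (ofReal_integral_le ?_).trans (lintegral_mono_set Set.Ioc_subset_Ioi_self)
          exact (hcont.integrableOn_Icc).mono_set Set.Ioc_subset_Icc_self
  · refine ENNReal.measurable_ofReal.comp (Measurable.div ?_ ?_)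
    · exact Continuous.measurable (by fun_prop)
    · exact Continuous.measurable (by fun_prop)

theorem planar_iso (V : ℂ → ℝ) (hV : ContDiff ℝ 1 V) (hc : HasCompactSupport V) (E : Set ℂ)
    (hE : MeasurableSet E) (hE1 : ∀ x ∈ E, 1 ≤ V x) :
    ENNReal.ofReal (2 * √(π * volume.real E)) ≤ ∫⁻ y, ENNReal.ofReal (gradN V y) := by
  have hfc : Continuous (fderiv ℝ V) := hV.continuous_fderiv (by simp)
  have hEfin : volume E ≠ ∞ := by
    refine ((measure_mono (fun x hx => ?_)).trans_lt hc.isCompact.measure_lt_top).ne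
    exact subset_tsupport V (by have := hE1 x hx; simp; linarith)
  by_cases hE0 : volume E = 0
  · simp [measureReal_def, hE0]
  have hA : 0 < volume.real E := ENNReal.toReal_pos hE0 hEfin
  have h1 : ENNReal.ofReal (2 * π) * volume E ≤
      (∫⁻ y, ENNReal.ofReal (gradN V y)) * ENNReal.ofReal (√(π * volume.real E)) := by
    calc ENNReal.ofReal (2 * π) * volume E = ∫⁻ x in E, ENNReal.ofReal (2 * π) := by simp
      _ ≤ ∫⁻ x in E, ∫⁻ y, ENNReal.ofReal (fderiv ℝ V y (x - y) / ‖x - y‖ ^ 2) := by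
          refine setLIntegral_mono' hE (fun x hx => ?_)
          refine le_trans ?_ (rep_ineq V hV hc x)
          have : (1 : ℝ≥0∞) ≤ ENNReal.ofReal (V x) := by
            rw [ENNReal.one_le_ofReal]; exact hE1 x hx
          exact le_mul_of_one_le_right zero_le this
      _ = ∫⁻ y, ∫⁻ x in E, ENNReal.ofReal (fderiv ℝ V y (x - y) / ‖x - y‖ ^ 2) := by
          rw [lintegral_lintegral_swap]
          refine (ENNReal.measurable_ofReal.comp (Measurable.div ?_ ?_)).aemeasurable
          · exact Continuous.measurable (by fun_prop)
          · exact Continuous.measurable (by fun_prop)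
      _ ≤ ∫⁻ y, ENNReal.ofReal (gradN V y) * ENNReal.ofReal (√(π * volume.real E)) :=
          lintegral_mono (fun y => bathtub_opt V y E hEfin hE0)
      _ = _ := by
          rw [lintegral_mul_const]
          refine ENNReal.measurable_ofReal.comp (Continuous.measurable ?_)
          unfold gradN
          fun_prop
  have hs : 0 < √(π * volume.real E) := Real.sqrt_pos.2 (by positivity)
  have h2 : ENNReal.ofReal (2 * √(π * volume.real E)) * ENNReal.ofReal (√(π * volume.real E))
      = ENNReal.ofReal (2 * π) * volume E := by
    rw [← ENNReal.ofReal_mul (by positivity), mul_assoc, Real.mul_self_sqrt (by positivity),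
      ← mul_assoc, ENNReal.ofReal_mul (by positivity)]
    congr 1
    exact ENNReal.ofReal_toReal hEfin
  rw [← h2] at h1
  have h3 : ENNReal.ofReal (√(π * volume.real E)) ≠ 0 := (ENNReal.ofReal_pos.2 hs).ne'
  exact (ENNReal.mul_le_mul_iff_left h3 ENNReal.ofReal_ne_top).1 h1

end PartC

/-! Part D: transfer to the catenoid -/

section PartD

open MeasureTheory
open scoped ENNReal

def qf (lam t : ℝ) : ℝ := √(t ^ 2 + lam ^ 2)

def rf (lam t : ℝ) : ℝ := (t + qf lam t) / lam

def sf (lam ρ : ℝ) : ℝ := lam / 2 * (ρ - ρ⁻¹)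

/-- gradient norm in lifted coordinates -/
def GU (lam : ℝ) (U : ℝ × ℝ → ℝ) (p : ℝ × ℝ) : ℝ :=
  √((fderiv ℝ U p (1, 0)) ^ 2 / (p.2 ^ 2 + lam ^ 2) + (fderiv ℝ U p (0, 1)) ^ 2)

def planarV (lam : ℝ) (U : ℝ × ℝ → ℝ) (z : ℂ) : ℝ :=
  if z = 0 then 0 else U (Complex.arg z, sf lam ‖z‖)

lemma qf_pos {lam : ℝ} (hl : 0 < lam) (t : ℝ) : 0 < qf lam t := Real.sqrt_pos.2 (by positivity)

lemma qf_sq (lam t : ℝ) : qf lam t ^ 2 = t ^ 2 + lam ^ 2 := Real.sq_sqrt (by positivity)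

lemma qf_neg (lam t : ℝ) : qf lam (-t) = qf lam t := by simp [qf]

lemma qf_continuous (lam : ℝ) : Continuous (qf lam) := by unfold qf; fun_prop

lemma rf_continuous (lam : ℝ) : Continuous (rf lam) := by unfold rf qf; fun_prop

lemma abs_lt_qf {lam : ℝ} (hl : 0 < lam) (t : ℝ) : |t| < qf lam t := by
  apply Real.lt_sqrt_of_sq_lt
  rw [sq_abs]
  have := pow_pos hl 2
  linarith

lemma rf_pos {lam : ℝ} (hl : 0 < lam) (t : ℝ) : 0 < rf lam t := by
  have := abs_lt_qf hl t
  have := neg_abs_le t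
  exact div_pos (by linarith) hl

lemma rf_mul_neg {lam : ℝ} (hl : 0 < lam) (t : ℝ) : rf lam t * rf lam (-t) = 1 := by
  unfold rf
  rw [qf_neg]
  have := qf_sq lam t
  field_simp
  nlinarith

lemma rf_add_neg {lam : ℝ} (hl : 0 < lam) (t : ℝ) : rf lam t + rf lam (-t) = 2 * qf lam t / lam := by
  unfold rf
  rw [qf_neg]
  field_simp
  ring

lemma qf_sf {lam ρ : ℝ} (hl : 0 < lam) (hρ : 0 < ρ) : qf lam (sf lam ρ) = lam / 2 * (ρ + ρ⁻¹) := by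
  unfold qf sf
  rw [show (lam / 2 * (ρ - ρ⁻¹)) ^ 2 + lam ^ 2 = (lam / 2 * (ρ + ρ⁻¹)) ^ 2 by field_simp; ring]
  exact Real.sqrt_sq (by positivity)

lemma rf_sf {lam ρ : ℝ} (hl : 0 < lam) (hρ : 0 < ρ) : rf lam (sf lam ρ) = ρ := by
  unfold rf
  rw [qf_sf hl hρ]
  unfold sf
  field_simp
  ring

lemma sf_rf {lam : ℝ} (hl : 0 < lam) (t : ℝ) : sf lam (rf lam t) = t := by
  have h1 : (rf lam t)⁻¹ = rf lam (-t) := inv_eq_of_mul_eq_one_right (rf_mul_neg hl t)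
  unfold sf
  rw [h1]
  unfold rf
  rw [qf_neg]
  field_simp
  ring

lemma sf_hasDerivAt {lam ρ : ℝ} (hl : 0 < lam) (hρ : 0 < ρ) :
    HasDerivAt (sf lam) (qf lam (sf lam ρ) / ρ) ρ := by
  have := ((hasDerivAt_id ρ).sub (hasDerivAt_inv hρ.ne')).const_mul (lam / 2)
  refine this.congr_deriv ?_
  rw [qf_sf hl hρ]
  field_simp
  ring

lemma sf_image {lam : ℝ} (hl : 0 < lam) : sf lam '' Set.Ioi 0 = Set.univ :=
  Set.eq_univ_of_forall fun t => ⟨rf lam t, rf_pos hl t, sf_rf hl t⟩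

lemma sf_inj {lam : ℝ} (hl : 0 < lam) : Set.InjOn (sf lam) (Set.Ioi 0) := by
  intro x hx y hy h
  rw [← rf_sf hl hx, ← rf_sf hl hy, h]

lemma sf_subst {lam : ℝ} (hl : 0 < lam) (g : ℝ → ℝ≥0∞) :
    ∫⁻ t, g t = ∫⁻ ρ in Set.Ioi (0 : ℝ), ENNReal.ofReal (qf lam (sf lam ρ) / ρ) * g (sf lam ρ) := by
  have := lintegral_image_eq_lintegral_abs_deriv_mul measurableSet_Ioi
    (fun x hx => (sf_hasDerivAt hl hx).hasDerivWithinAt) (sf_inj hl) g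
  rw [sf_image hl, Measure.restrict_univ] at this
  rw [this]
  refine setLIntegral_congr_fun measurableSet_Ioi (fun ρ hρ => ?_)
  have hρ : 0 < ρ := hρ
  have := qf_pos hl (sf lam ρ)
  rw [abs_of_pos (by positivity)]

lemma per_int {U : ℝ × ℝ → ℝ} (hper : ∀ θ t, U (θ + 2 * π, t) = U (θ, t)) {a b : ℝ} (n : ℤ)
    (h : a - b = 2 * π * n) (t : ℝ) : U (a, t) = U (b, t) := by
  have hp : Function.Periodic (fun θ => U (θ, t)) (2 * π) := fun θ => hper θ t
  have := hp.int_mul n b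
  rw [← this]
  congr 2
  linarith

lemma planarV_polar {lam : ℝ} {U : ℝ × ℝ → ℝ} (hper : ∀ θ t, U (θ + 2 * π, t) = U (θ, t))
    {ρ : ℝ} (hρ : 0 < ρ) (φ : ℝ) :
    planarV lam U (ρ * (Real.cos φ + Real.sin φ * Complex.I)) = U (φ, sf lam ρ) := by
  have hn : ‖(Real.cos φ + Real.sin φ * Complex.I : ℂ)‖ = 1 := by
    rw [Complex.ofReal_cos, Complex.ofReal_sin, ← Complex.exp_mul_I]
    exact Complex.norm_exp_ofReal_mul_I φ
  have hn2 : ‖(ρ * (Real.cos φ + Real.sin φ * Complex.I) : ℂ)‖ = ρ := by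
    rw [norm_mul, hn, mul_one, Complex.norm_real, Real.norm_of_nonneg hρ.le]
  have h0 : (ρ * (Real.cos φ + Real.sin φ * Complex.I) : ℂ) ≠ 0 := by
    rw [← norm_pos_iff, hn2]; exact hρ
  unfold planarV
  rw [if_neg h0, hn2]
  have := Complex.arg_mul_cos_add_sin_mul_I_sub hρ φ
  rw [← Complex.ofReal_cos, ← Complex.ofReal_sin] at this
  exact per_int hper _ this _

lemma planarV_zero_near {lam : ℝ} (hl : 0 < lam) {U : ℝ × ℝ → ℝ} {T : ℝ}
    (hT : ∀ p : ℝ × ℝ, T ≤ |p.2| → U p = 0) {z : ℂ} (hz : ‖z‖ ≤ 1 / (2 * |T| / lam + 1)) :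
    planarV lam U z = 0 := by
  unfold planarV
  split_ifs with h
  · rfl
  apply hT
  have hz0 : 0 < ‖z‖ := norm_pos_iff.2 h
  have hK : 1 ≤ 2 * |T| / lam + 1 := by
    have : 0 ≤ 2 * |T| / lam := by positivity
    linarith
  have h1 : 2 * |T| / lam + 1 ≤ ‖z‖⁻¹ := by
    rw [le_div_iff₀ (by linarith)] at hz
    rw [← one_div, le_div_iff₀ hz0]; linarith
  have h2 : ‖z‖ ≤ 1 := hz.trans (by rw [div_le_one (by linarith)]; exact hK)
  refine le_trans ?_ (neg_le_abs _)
  simp only [sf]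
  have h3 : 2 * |T| / lam ≤ ‖z‖⁻¹ - ‖z‖ := by linarith
  rw [div_le_iff₀ hl] at h3
  have := le_abs_self T
  nlinarith

lemma planarV_zero_far {lam : ℝ} (hl : 0 < lam) {U : ℝ × ℝ → ℝ} {T : ℝ}
    (hT : ∀ p : ℝ × ℝ, T ≤ |p.2| → U p = 0) {z : ℂ} (hz : 2 * |T| / lam + 1 ≤ ‖z‖) :
    planarV lam U z = 0 := by
  unfold planarV
  split_ifs with h
  · rfl
  apply hT
  have hz0 : 0 < ‖z‖ := norm_pos_iff.2 h
  have hK : 1 ≤ 2 * |T| / lam + 1 := by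
    have : 0 ≤ 2 * |T| / lam := by positivity
    linarith
  have h2 : ‖z‖⁻¹ ≤ 1 := inv_le_one_of_one_le₀ (hK.trans hz)
  refine le_trans ?_ (le_abs_self _)
  simp only [sf]
  have h3 : 2 * |T| / lam ≤ ‖z‖ - ‖z‖⁻¹ := by linarith
  rw [div_le_iff₀ hl] at h3
  have := le_abs_self T
  nlinarith

lemma planarV_compact {lam : ℝ} (hl : 0 < lam) {U : ℝ × ℝ → ℝ} {T : ℝ}
    (hT : ∀ p : ℝ × ℝ, T ≤ |p.2| → U p = 0) : HasCompactSupport (planarV lam U) := by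
  refine HasCompactSupport.intro (isCompact_closedBall (0 : ℂ) (2 * |T| / lam + 1)) (fun z hz => ?_)
  refine planarV_zero_far hl hT ?_
  rw [mem_closedBall_zero_iff] at hz
  linarith

lemma planarV_contDiff {lam : ℝ} (hl : 0 < lam) {U : ℝ × ℝ → ℝ} (hU : ContDiff ℝ 1 U)
    (hper : ∀ θ t, U (θ + 2 * π, t) = U (θ, t)) {T : ℝ}
    (hT : ∀ p : ℝ × ℝ, T ≤ |p.2| → U p = 0) : ContDiff ℝ 1 (planarV lam U) := by
  rw [contDiff_iff_contDiffAt]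
  intro z₀
  by_cases hz : z₀ = 0
  · have hev : planarV lam U =ᶠ[𝓝 z₀] fun _ => 0 := by
      have : Metric.ball (0 : ℂ) (1 / (2 * |T| / lam + 1)) ∈ 𝓝 z₀ := by
        rw [hz]; exact Metric.ball_mem_nhds _ (by positivity)
      filter_upwards [this] with z hz
      rw [mem_ball_zero_iff] at hz
      exact planarV_zero_near hl hT hz.le
    exact (contDiffAt_const).congr_of_eventuallyEq hev
  · have hev : planarV lam U =ᶠ[𝓝 z₀] fun z => U ((Complex.log (z / z₀)).im + z₀.arg, sf lam ‖z‖) := by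
      filter_upwards [isOpen_ne.mem_nhds hz] with z hz'
      have hz' : z ≠ 0 := hz'
      unfold planarV
      rw [if_neg hz', Complex.log_im]
      have := Complex.arg_div_coe_angle hz' hz
      have h2 : ((Complex.arg (z / z₀) + Complex.arg z₀ : ℝ) : Real.Angle) = (Complex.arg z : ℝ) := by
        rw [Real.Angle.coe_add, this]; simp
      obtain ⟨k, hk⟩ := Real.Angle.angle_eq_iff_two_pi_dvd_sub.1 h2.symm
      exact per_int hper k hk _
    refine ContDiffAt.congr_of_eventuallyEq ?_ hev
    refine hU.contDiffAt.comp z₀ (ContDiffAt.prodMk ?_ ?_)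
    · refine ContDiffAt.add ?_ contDiffAt_const
      have h1 : ContDiffAt ℝ 1 (fun z : ℂ => Complex.log (z / z₀)) z₀ := by
        have h2 : ContDiffAt ℝ 1 Complex.log (z₀ / z₀) := by
          refine (Complex.contDiffAt_log ?_).restrict_scalars ℝ
          rw [div_self hz]; exact Complex.one_mem_slitPlane
        have h3 : ContDiffAt ℝ 1 (fun z : ℂ => z / z₀) z₀ := by
          exact contDiffAt_id.div_const z₀
        exact ContDiffAt.comp (f := fun z : ℂ => z / z₀) z₀ h2 h3
      exact Complex.imCLM.contDiff.contDiffAt.comp z₀ h1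
    · unfold sf
      have hn : ContDiffAt ℝ 1 (fun z : ℂ => ‖z‖) z₀ := contDiffAt_norm ℝ hz
      exact contDiffAt_const.mul (hn.sub (hn.inv (norm_ne_zero_iff.2 hz)))

lemma gradN_sq_rot (L : ℂ →L[ℝ] ℝ) (φ : ℝ) :
    (L 1) ^ 2 + (L Complex.I) ^ 2 = (L (Real.cos φ + Real.sin φ * Complex.I)) ^ 2 +
      (L (-Real.sin φ + Real.cos φ * Complex.I)) ^ 2 := by
  rw [fderiv_decomp L (Real.cos φ + Real.sin φ * Complex.I),
    fderiv_decomp L (-Real.sin φ + Real.cos φ * Complex.I)]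
  have e1 : (Real.cos φ + Real.sin φ * Complex.I : ℂ).re = Real.cos φ := by
    simp [-Complex.ofReal_cos, -Complex.ofReal_sin]
  have e2 : (Real.cos φ + Real.sin φ * Complex.I : ℂ).im = Real.sin φ := by
    simp [-Complex.ofReal_cos, -Complex.ofReal_sin]
  have e3 : (-Real.sin φ + Real.cos φ * Complex.I : ℂ).re = -Real.sin φ := by
    simp [-Complex.ofReal_cos, -Complex.ofReal_sin]
  have e4 : (-Real.sin φ + Real.cos φ * Complex.I : ℂ).im = Real.cos φ := by
    simp [-Complex.ofReal_cos, -Complex.ofReal_sin]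
  rw [e1, e2, e3, e4]
  have := Real.sin_sq_add_cos_sq φ
  have h : ∀ a b s c : ℝ, s ^ 2 + c ^ 2 = 1 → a ^ 2 + b ^ 2 = (a * c + b * s) ^ 2 + (a * -s + b * c) ^ 2 := by
    intro a b s c h
    linear_combination (-(a ^ 2) - b ^ 2) * h
  exact h _ _ _ _ this

lemma planarV_grad {lam : ℝ} (hl : 0 < lam) {U : ℝ × ℝ → ℝ} (hU : ContDiff ℝ 1 U)
    (hper : ∀ θ t, U (θ + 2 * π, t) = U (θ, t)) {T : ℝ}
    (hT : ∀ p : ℝ × ℝ, T ≤ |p.2| → U p = 0) {ρ : ℝ} (hρ : 0 < ρ) (φ : ℝ) :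
    gradN (planarV lam U) (ρ * (Real.cos φ + Real.sin φ * Complex.I)) =
      qf lam (sf lam ρ) / ρ * GU lam U (φ, sf lam ρ) := by
  have hV := planarV_contDiff hl hU hper hT
  set z : ℂ := ρ * (Real.cos φ + Real.sin φ * Complex.I) with hz
  have hVd : HasFDerivAt (planarV lam U) (fderiv ℝ (planarV lam U) z) z :=
    ((hV.differentiable (by simp)) z).hasFDerivAt
  have hUd : HasFDerivAt U (fderiv ℝ U (φ, sf lam ρ)) (φ, sf lam ρ) :=
    ((hU.differentiable (by simp)) _).hasFDerivAt
  set L := fderiv ℝ (planarV lam U) z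
  set M := fderiv ℝ U (φ, sf lam ρ) with hM
  have h1 : L (Real.cos φ + Real.sin φ * Complex.I) = qf lam (sf lam ρ) / ρ * M (0, 1) := by
    have c1 : HasDerivAt (fun r : ℝ => (r : ℂ) * (Real.cos φ + Real.sin φ * Complex.I))
        (Real.cos φ + Real.sin φ * Complex.I) ρ := by
      simpa using (Complex.ofRealCLM.hasDerivAt (x := ρ)).mul_const (Real.cos φ + Real.sin φ * Complex.I : ℂ)
    have d1 := hVd.comp_hasDerivAt ρ c1
    have c2 : HasDerivAt (fun r : ℝ => (φ, sf lam r)) ((0 : ℝ), qf lam (sf lam ρ) / ρ) ρ :=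
      (hasDerivAt_const ρ φ).prodMk (sf_hasDerivAt hl hρ)
    have d2 := hUd.comp_hasDerivAt ρ c2
    have hev : (planarV lam U ∘ fun r : ℝ => (r : ℂ) * (Real.cos φ + Real.sin φ * Complex.I)) =ᶠ[𝓝 ρ]
        (U ∘ fun r : ℝ => (φ, sf lam r)) := by
      filter_upwards [Ioi_mem_nhds hρ] with r hr
      exact planarV_polar hper hr φ
    have := d1.unique (d2.congr_of_eventuallyEq hev)
    rw [this, show ((0 : ℝ), qf lam (sf lam ρ) / ρ) = (qf lam (sf lam ρ) / ρ) • ((0 : ℝ), (1 : ℝ)) by simp,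
      map_smul, smul_eq_mul]
  have h2 : ρ * L (-Real.sin φ + Real.cos φ * Complex.I) = M (1, 0) := by
    have c1 : HasDerivAt (fun r : ℝ => (ρ : ℂ) * (Real.cos r + Real.sin r * Complex.I))
        (ρ * (-Real.sin φ + Real.cos φ * Complex.I)) φ := by
      have a1 := (Real.hasDerivAt_cos φ).ofReal_comp
      have a2 := ((Real.hasDerivAt_sin φ).ofReal_comp).mul_const Complex.I
      have a3 := (a1.add a2).const_mul (ρ : ℂ)
      refine a3.congr_deriv ?_
      simp
    have d1 := hVd.comp_hasDerivAt φ c1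
    have c2 : HasDerivAt (fun r : ℝ => (r, sf lam ρ)) ((1 : ℝ), (0 : ℝ)) φ :=
      (hasDerivAt_id φ).prodMk (hasDerivAt_const φ _)
    have d2 := hUd.comp_hasDerivAt φ c2
    have hev : (planarV lam U ∘ fun r : ℝ => (ρ : ℂ) * (Real.cos r + Real.sin r * Complex.I)) =
        (U ∘ fun r : ℝ => (r, sf lam ρ)) := by
      funext r
      exact planarV_polar hper hρ r
    rw [hev] at d1
    have := d1.unique d2
    rw [← this, show (ρ : ℂ) * (-Real.sin φ + Real.cos φ * Complex.I) =
      ρ • (-Real.sin φ + Real.cos φ * Complex.I : ℂ) from (Complex.real_smul).symm, map_smul, smul_eq_mul]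
  have hq := qf_pos hl (sf lam ρ)
  have hg : gradN (planarV lam U) z = √((L 1) ^ 2 + (L Complex.I) ^ 2) := rfl
  rw [hg, gradN_sq_rot L φ, h1]
  have h3 : L (-Real.sin φ + Real.cos φ * Complex.I) = M (1, 0) / ρ := by
    rw [← h2]; field_simp
  rw [h3]
  have hGU : GU lam U (φ, sf lam ρ) = √((M (1, 0)) ^ 2 / qf lam (sf lam ρ) ^ 2 + (M (0, 1)) ^ 2) := by
    rw [qf_sq]; rfl
  rw [hGU, ← Real.sqrt_sq (show 0 ≤ qf lam (sf lam ρ) / ρ by positivity), ← Real.sqrt_mul (by positivity)]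
  congr 1
  rw [Real.sqrt_sq (by positivity)]
  field_simp
  ring

/-- coordinate measure -/
def nuM : Measure (ℝ × ℝ) := (volume.restrict (Set.Ioo (-π) π)).prod volume

lemma GU_continuous {lam : ℝ} (hl : 0 < lam) {U : ℝ × ℝ → ℝ} (hU : ContDiff ℝ 1 U) :
    Continuous (GU lam U) := by
  have hfc : Continuous (fderiv ℝ U) := hU.continuous_fderiv (by simp)
  have hne : ∀ p : ℝ × ℝ, p.2 ^ 2 + lam ^ 2 ≠ 0 := fun p => by positivity
  unfold GU
  refine Continuous.sqrt (Continuous.add (Continuous.div ?_ ?_ hne) ?_) <;> fun_prop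

lemma half_iso {lam : ℝ} (hl : 0 < lam) {U : ℝ × ℝ → ℝ} (hU : ContDiff ℝ 1 U)
    (hper : ∀ θ t, U (θ + 2 * π, t) = U (θ, t)) {T : ℝ}
    (hT : ∀ p : ℝ × ℝ, T ≤ |p.2| → U p = 0) {E : Set (ℝ × ℝ)} (hE : MeasurableSet E)
    (hE1 : ∀ p ∈ E, 1 ≤ U p) :
    ENNReal.ofReal (2 * √(π * (∫⁻ p in E, ENNReal.ofReal (rf lam p.2 ^ 2 / qf lam p.2) ∂nuM).toReal)) ≤
      ∫⁻ p, ENNReal.ofReal (rf lam p.2 * GU lam U p) ∂nuM := by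
  have hV := planarV_contDiff hl hU hper hT
  set F : Set ℂ := {0}ᶜ ∩ (fun z : ℂ => (Complex.arg z, sf lam ‖z‖)) ⁻¹' E with hF
  have hmeas : Measurable (fun z : ℂ => (Complex.arg z, sf lam ‖z‖)) := by
    refine Measurable.prodMk Complex.measurable_arg ?_
    unfold sf
    exact measurable_const.mul (measurable_norm.sub measurable_norm.inv)
  have hFm : MeasurableSet F := (MeasurableSet.singleton 0).compl.inter (hmeas hE)
  have hF1 : ∀ z ∈ F, 1 ≤ planarV lam U z := by
    intro z hz
    have h0 : z ≠ 0 := hz.1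
    unfold planarV
    rw [if_neg h0]
    exact hE1 _ hz.2
  have key := planar_iso (planarV lam U) hV (planarV_compact hl hT) F hFm hF1
  have e1 : volume F = ∫⁻ p in E, ENNReal.ofReal (rf lam p.2 ^ 2 / qf lam p.2) ∂nuM := by
    rw [← lintegral_indicator_one hFm, polar_lintegral _ (measurable_one.indicator hFm),
      ← lintegral_indicator hE, nuM, lintegral_prod]
    · refine setLIntegral_congr_fun measurableSet_Ioo (fun φ hφ => ?_)
      rw [sf_subst hl]
      refine setLIntegral_congr_fun measurableSet_Ioi (fun ρ hρ => ?_)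
      have hρ : 0 < ρ := hρ
      have hn : ‖(Real.cos φ + Real.sin φ * Complex.I : ℂ)‖ = 1 := by
        rw [Complex.ofReal_cos, Complex.ofReal_sin, ← Complex.exp_mul_I]
        exact Complex.norm_exp_ofReal_mul_I φ
      have hn2 : ‖(ρ * (Real.cos φ + Real.sin φ * Complex.I) : ℂ)‖ = ρ := by
        rw [norm_mul, hn, mul_one, Complex.norm_real, Real.norm_of_nonneg hρ.le]
      have h0 : (ρ * (Real.cos φ + Real.sin φ * Complex.I) : ℂ) ≠ 0 := by
        rw [← norm_pos_iff, hn2]; exact hρ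
      have harg : Complex.arg (ρ * (Real.cos φ + Real.sin φ * Complex.I)) = φ := by
        rw [Complex.ofReal_cos, Complex.ofReal_sin]
        exact Complex.arg_mul_cos_add_sin_mul_I hρ ⟨hφ.1, hφ.2.le⟩
      have hq := qf_pos hl (sf lam ρ)
      by_cases hm : (φ, sf lam ρ) ∈ E
      · have hm2 : (ρ * (Real.cos φ + Real.sin φ * Complex.I) : ℂ) ∈ F := by
          refine ⟨h0, ?_⟩
          rw [Set.mem_preimage, harg, hn2]; exact hm
        rw [Set.indicator_of_mem hm2, Set.indicator_of_mem hm, ← ENNReal.ofReal_mul (by positivity),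
          Pi.one_apply, mul_one]
        congr 1
        simp only
        rw [rf_sf hl hρ]
        field_simp
      · have hm2 : (ρ * (Real.cos φ + Real.sin φ * Complex.I) : ℂ) ∉ F := by
          intro h
          have := h.2
          rw [Set.mem_preimage, harg, hn2] at this; exact hm this
        rw [Set.indicator_of_notMem hm2, Set.indicator_of_notMem hm, mul_zero, mul_zero]
    · refine (Measurable.indicator ?_ hE).aemeasurable
      refine ENNReal.measurable_ofReal.comp (Measurable.div ?_ ?_)
      · exact (((rf_continuous lam).comp continuous_snd).pow 2).measurable
      · exact ((qf_continuous lam).comp continuous_snd).measurable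
  have e2 : ∫⁻ y, ENNReal.ofReal (gradN (planarV lam U) y) =
      ∫⁻ p, ENNReal.ofReal (rf lam p.2 * GU lam U p) ∂nuM := by
    rw [polar_lintegral, nuM, lintegral_prod]
    · refine setLIntegral_congr_fun measurableSet_Ioo (fun φ hφ => ?_)
      rw [sf_subst hl]
      refine setLIntegral_congr_fun measurableSet_Ioi (fun ρ hρ => ?_)
      have hρ : 0 < ρ := hρ
      have hq := qf_pos hl (sf lam ρ)
      rw [planarV_grad hl hU hper hT hρ, ← ENNReal.ofReal_mul hρ.le, ← ENNReal.ofReal_mul (by positivity)]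
      congr 1
      simp only
      rw [rf_sf hl hρ]
      field_simp
    · refine (ENNReal.measurable_ofReal.comp (Continuous.measurable ?_)).aemeasurable
      exact ((rf_continuous lam).comp continuous_snd).mul (GU_continuous hl hU)
    · refine ENNReal.measurable_ofReal.comp (Continuous.measurable ?_)
      have hfc : Continuous (fderiv ℝ (planarV lam U)) := hV.continuous_fderiv (by simp)
      unfold gradN
      fun_prop
  rw [e2, measureReal_def, e1] at key
  exact key

end PartD

section PartD2

open MeasureTheory
open scoped ENNReal

def flipT (p : ℝ × ℝ) : ℝ × ℝ := (p.1, -p.2)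

lemma flipT_mp : MeasurePreserving flipT nuM nuM := by
  have h := (MeasurePreserving.id (volume.restrict (Set.Ioo (-π) π))).prod
    (Measure.measurePreserving_neg (volume : Measure ℝ))
  exact h

lemma flipT_continuous : Continuous flipT := by unfold flipT; fun_prop

lemma lint_flip (f : ℝ × ℝ → ℝ≥0∞) (hf : Measurable f) :
    ∫⁻ p, f (flipT p) ∂nuM = ∫⁻ p, f p ∂nuM := flipT_mp.lintegral_comp hf

lemma GU_flip (lam : ℝ) {U : ℝ × ℝ → ℝ} (hU : ContDiff ℝ 1 U) (p : ℝ × ℝ) :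
    GU lam (fun p => U (flipT p)) p = GU lam U (flipT p) := by
  let R : ℝ × ℝ →L[ℝ] ℝ × ℝ := (ContinuousLinearMap.fst ℝ ℝ ℝ).prod (-(ContinuousLinearMap.snd ℝ ℝ ℝ))
  have hR : ∀ p, flipT p = R p := fun p => rfl
  have h1 : HasFDerivAt U (fderiv ℝ U (flipT p)) (flipT p) :=
    ((hU.differentiable (by simp)) _).hasFDerivAt
  have h2 : HasFDerivAt (fun p => U (flipT p)) ((fderiv ℝ U (flipT p)).comp R) p :=
    HasFDerivAt.comp (f := flipT) p h1 R.hasFDerivAt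
  unfold GU
  rw [h2.fderiv]
  have e1 : ((fderiv ℝ U (flipT p)).comp R) (1, 0) = fderiv ℝ U (flipT p) (1, 0) := by
    simp [R]
  have e2 : ((fderiv ℝ U (flipT p)).comp R) (0, 1) = - fderiv ℝ U (flipT p) (0, 1) := by
    rw [← map_neg]
    simp [R]
  rw [e1, e2]
  simp [flipT]

lemma half_iso_neg {lam : ℝ} (hl : 0 < lam) {U : ℝ × ℝ → ℝ} (hU : ContDiff ℝ 1 U)
    (hper : ∀ θ t, U (θ + 2 * π, t) = U (θ, t)) {T : ℝ}
    (hT : ∀ p : ℝ × ℝ, T ≤ |p.2| → U p = 0) {E : Set (ℝ × ℝ)} (hE : MeasurableSet E)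
    (hE1 : ∀ p ∈ E, 1 ≤ U p) :
    ENNReal.ofReal (2 * √(π * (∫⁻ p in E, ENNReal.ofReal (rf lam (-p.2) ^ 2 / qf lam p.2) ∂nuM).toReal)) ≤
      ∫⁻ p, ENNReal.ofReal (rf lam (-p.2) * GU lam U p) ∂nuM := by
  have hfl : ContDiff ℝ 1 flipT := by unfold flipT; fun_prop
  have hEm : MeasurableSet (flipT ⁻¹' E) := flipT_continuous.measurable hE
  have key := half_iso hl (U := fun p => U (flipT p)) (hU.comp hfl) (fun θ t => hper θ (-t)) (T := T)
    (fun p hp => hT _ (by simpa [flipT] using hp)) (E := flipT ⁻¹' E) hEm (fun p hp => hE1 _ hp)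
  have e1 : ∫⁻ p in flipT ⁻¹' E, ENNReal.ofReal (rf lam p.2 ^ 2 / qf lam p.2) ∂nuM =
      ∫⁻ p in E, ENNReal.ofReal (rf lam (-p.2) ^ 2 / qf lam p.2) ∂nuM := by
    rw [← lintegral_indicator hEm, ← lintegral_indicator hE,
      ← lint_flip (E.indicator fun p => ENNReal.ofReal (rf lam (-p.2) ^ 2 / qf lam p.2))]
    · refine lintegral_congr fun p => ?_
      by_cases h : flipT p ∈ E
      · rw [Set.indicator_of_mem (show p ∈ flipT ⁻¹' E from h), Set.indicator_of_mem h]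
        simp [flipT, qf_neg]
      · rw [Set.indicator_of_notMem (show p ∉ flipT ⁻¹' E from h), Set.indicator_of_notMem h]
    · refine Measurable.indicator ?_ hE
      refine ENNReal.measurable_ofReal.comp (Measurable.div ?_ ?_)
      · exact (((rf_continuous lam).comp continuous_snd.neg).pow 2).measurable
      · exact ((qf_continuous lam).comp continuous_snd).measurable
  have e2 : ∫⁻ p, ENNReal.ofReal (rf lam p.2 * GU lam (fun p => U (flipT p)) p) ∂nuM =
      ∫⁻ p, ENNReal.ofReal (rf lam (-p.2) * GU lam U p) ∂nuM := by
    rw [← lint_flip (fun p => ENNReal.ofReal (rf lam (-p.2) * GU lam U p))]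
    · refine lintegral_congr fun p => ?_
      rw [GU_flip lam hU]
      simp [flipT]
    · refine ENNReal.measurable_ofReal.comp (Continuous.measurable ?_)
      exact ((rf_continuous lam).comp continuous_snd.neg).mul (GU_continuous hl hU)
  rw [e1, e2] at key
  exact key

/-- volume in lifted coordinates -/
def cvM (lam : ℝ) : Measure (ℝ × ℝ) := nuM.withDensity fun p => ENNReal.ofReal (qf lam p.2)

lemma qf_snd_meas (lam : ℝ) : Measurable fun p : ℝ × ℝ => ENNReal.ofReal (qf lam p.2) :=
  ENNReal.measurable_ofReal.comp ((qf_continuous lam).comp continuous_snd).measurable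

lemma cvM_lintegral (lam : ℝ) {f : ℝ × ℝ → ℝ≥0∞} (hf : Measurable f) :
    ∫⁻ p, f p ∂cvM lam = ∫⁻ p, ENNReal.ofReal (qf lam p.2) * f p ∂nuM :=
  lintegral_withDensity_eq_lintegral_mul _ (qf_snd_meas lam) hf

lemma cvM_apply (lam : ℝ) {E : Set (ℝ × ℝ)} (hE : MeasurableSet E) :
    cvM lam E = ∫⁻ p in E, ENNReal.ofReal (qf lam p.2) ∂nuM := withDensity_apply _ hE

lemma full_iso {lam : ℝ} (hl : 0 < lam) {U : ℝ × ℝ → ℝ} (hU : ContDiff ℝ 1 U)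
    (hper : ∀ θ t, U (θ + 2 * π, t) = U (θ, t)) {T : ℝ}
    (hT : ∀ p : ℝ × ℝ, T ≤ |p.2| → U p = 0) {E : Set (ℝ × ℝ)} (hE : MeasurableSet E)
    (hE1 : ∀ p ∈ E, 1 ≤ U p) :
    ENNReal.ofReal (lam * √π *
      (√((∫⁻ p in E, ENNReal.ofReal (rf lam p.2 ^ 2 / qf lam p.2) ∂nuM).toReal) +
        √((∫⁻ p in E, ENNReal.ofReal (rf lam (-p.2) ^ 2 / qf lam p.2) ∂nuM).toReal))) ≤
      ∫⁻ p, ENNReal.ofReal (GU lam U p) ∂cvM lam := by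
  have k1 := half_iso hl hU hper hT hE hE1
  have k2 := half_iso_neg hl hU hper hT hE hE1
  set A1 := (∫⁻ p in E, ENNReal.ofReal (rf lam p.2 ^ 2 / qf lam p.2) ∂nuM).toReal
  set A2 := (∫⁻ p in E, ENNReal.ofReal (rf lam (-p.2) ^ 2 / qf lam p.2) ∂nuM).toReal
  have hG := GU_continuous hl hU
  rw [cvM_lintegral lam (f := fun p => ENNReal.ofReal (GU lam U p)) (ENNReal.measurable_ofReal.comp hG.measurable)]
  have e : ∫⁻ p, ENNReal.ofReal (qf lam p.2) * ENNReal.ofReal (GU lam U p) ∂nuM =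
      ENNReal.ofReal (lam / 2) * (∫⁻ p, ENNReal.ofReal (rf lam p.2 * GU lam U p) ∂nuM +
        ∫⁻ p, ENNReal.ofReal (rf lam (-p.2) * GU lam U p) ∂nuM) := by
    have m1 : Measurable fun p : ℝ × ℝ => ENNReal.ofReal (rf lam p.2 * GU lam U p) :=
      ENNReal.measurable_ofReal.comp (((rf_continuous lam).comp continuous_snd).mul hG).measurable
    have m2 : Measurable fun p : ℝ × ℝ => ENNReal.ofReal (rf lam (-p.2) * GU lam U p) :=
      ENNReal.measurable_ofReal.comp (((rf_continuous lam).comp continuous_snd.neg).mul hG).measurable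
    have m12 : Measurable fun p : ℝ × ℝ => ENNReal.ofReal (rf lam p.2 * GU lam U p) +
      ENNReal.ofReal (rf lam (-p.2) * GU lam U p) := m1.add m2
    rw [← lintegral_add_left m1, ← lintegral_const_mul _ m12]
    refine lintegral_congr fun p => ?_
    have hg0 : 0 ≤ GU lam U p := Real.sqrt_nonneg _
    have r1 := rf_pos hl p.2
    have r2 := rf_pos hl (-p.2)
    rw [← ENNReal.ofReal_add (by positivity) (by positivity), ← ENNReal.ofReal_mul (qf_pos hl _).le,
      ← ENNReal.ofReal_mul (by positivity)]
    congr 1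
    rw [← add_mul, rf_add_neg hl]
    field_simp
  rw [e]
  refine le_trans (le_of_eq ?_) (mul_le_mul_right (add_le_add k1 k2) _)
  rw [← ENNReal.ofReal_add (by positivity) (by positivity), ← ENNReal.ofReal_mul (by positivity),
    Real.sqrt_mul Real.pi_pos.le, Real.sqrt_mul Real.pi_pos.le]
  congr 1
  ring

def Xcat (lam c t : ℝ) : ℝ := c * rf lam t - c⁻¹ * rf lam (-t)

lemma Xcat_diff {lam : ℝ} (hl : 0 < lam) {c : ℝ} (hc : 0 < c) {T t1 t2 : ℝ} (h1 : |t1| ≤ T)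
    (h2 : |t2| ≤ T) (h12 : t1 ≤ t2) :
    2 / lam * (1 - T / qf lam T) * (t2 - t1) ≤ Xcat lam c t2 - Xcat lam c t1 := by
  have hT0 : 0 ≤ T := (abs_nonneg _).trans h1
  have hqT := qf_pos hl T
  have hth1 : T / qf lam T < 1 := by
    rw [div_lt_one hqT]; have := abs_lt_qf hl T; rwa [abs_of_nonneg hT0] at this
  set th := T / qf lam T with hth
  have hq : ∀ t, |t| ≤ T → |t| ≤ th * qf lam t := by
    intro t ht
    have := qf_pos hl t
    rw [hth, div_mul_eq_mul_div, le_div_iff₀ hqT]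
    apply le_of_sq_le_sq _ (by positivity) 
    rw [mul_pow, mul_pow, qf_sq, qf_sq, sq_abs]
    have : t ^ 2 ≤ T ^ 2 := sq_le_sq' (by linarith [neg_abs_le t]) ((le_abs_self t).trans ht)
    nlinarith [pow_pos hl 2]
  have hs : |t1 + t2| ≤ th * (qf lam t1 + qf lam t2) := by
    have := abs_add_le t1 t2
    have := hq t1 h1
    have := hq t2 h2
    linarith
  have hq1 := qf_pos hl t1
  have hq2 := qf_pos hl t2
  have hdq : |qf lam t2 - qf lam t1| ≤ th * (t2 - t1) := by
    have e : (qf lam t2 - qf lam t1) * (qf lam t1 + qf lam t2) = (t2 - t1) * (t1 + t2) := by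
      have a := qf_sq lam t1
      have b := qf_sq lam t2
      linear_combination b - a
    have e2 : |qf lam t2 - qf lam t1| * (qf lam t1 + qf lam t2) = (t2 - t1) * |t1 + t2| := by
      rw [← abs_of_pos (show 0 < qf lam t1 + qf lam t2 by linarith), ← abs_mul, e, abs_mul,
        abs_of_nonneg (show 0 ≤ t2 - t1 by linarith)]
    have : |qf lam t2 - qf lam t1| * (qf lam t1 + qf lam t2) ≤ (th * (t2 - t1)) * (qf lam t1 + qf lam t2) := by
      rw [e2]
      have := mul_le_mul_of_nonneg_left hs (show 0 ≤ t2 - t1 by linarith)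
      linarith
    exact le_of_mul_le_mul_right this (by linarith)
  have hci : 0 < c⁻¹ := inv_pos.2 hc
  have hcc : c * c⁻¹ = 1 := mul_inv_cancel₀ hc.ne'
  have hc2 : 2 ≤ c + c⁻¹ := by nlinarith [sq_nonneg (c - c⁻¹)]
  have hX : Xcat lam c t2 - Xcat lam c t1 = ((c + c⁻¹) * (t2 - t1) + (c - c⁻¹) * (qf lam t2 - qf lam t1)) / lam := by
    unfold Xcat rf
    rw [qf_neg, qf_neg]
    ring
  rw [hX, le_div_iff₀ hl]
  have hb : |c - c⁻¹| ≤ c + c⁻¹ := by rw [abs_le]; constructor <;> linarith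
  have h3 : -((c + c⁻¹) * (th * (t2 - t1))) ≤ (c - c⁻¹) * (qf lam t2 - qf lam t1) := by
    have := neg_abs_le ((c - c⁻¹) * (qf lam t2 - qf lam t1))
    rw [abs_mul] at this
    have := mul_le_mul hb hdq (abs_nonneg _) (by linarith)
    linarith
  have h4 : 2 / lam * (1 - th) * (t2 - t1) * lam = 2 * ((1 - th) * (t2 - t1)) := by field_simp
  rw [h4]
  have h5 := mul_le_mul_of_nonneg_right hc2 (show 0 ≤ (1 - th) * (t2 - t1) from mul_nonneg (by linarith) (by linarith))
  linarith

lemma gap {lam : ℝ} (hl : 0 < lam) {m : ℝ} (hm : 0 < m) {Ω : Set (ℝ × ℝ)} (hΩ : MeasurableSet Ω)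
    (hvol : cvM lam Ω = ENNReal.ofReal m) :
    ∃ δ : ℝ, 0 < δ ∧ ∀ E : Set (ℝ × ℝ), MeasurableSet E → E ⊆ Ω → ENNReal.ofReal (m / 2) ≤ cvM lam E →
      ∀ c : ℝ, 0 < c → ENNReal.ofReal δ ≤ ∫⁻ p in E, ENNReal.ofReal (Xcat lam c p.2 ^ 2 / qf lam p.2) ∂nuM := by
  have hX : ∀ c, Continuous (Xcat lam c) := fun c => by
    have := rf_continuous lam
    unfold Xcat
    fun_prop
  obtain ⟨n, hn⟩ : ∃ n : ℕ, cvM lam (Ω ∩ {p | (n : ℝ) < |p.2|}) ≤ ENNReal.ofReal (m / 4) := by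
    have hms : ∀ n : ℕ, MeasurableSet (Ω ∩ {p : ℝ × ℝ | (n : ℝ) < |p.2|}) := fun n =>
      hΩ.inter (measurableSet_lt measurable_const (Continuous.measurable (by fun_prop)))
    have ht := tendsto_measure_iInter_atTop (μ := cvM lam)
      (s := fun n : ℕ => Ω ∩ {p : ℝ × ℝ | (n : ℝ) < |p.2|}) (fun n => (hms n).nullMeasurableSet)
      (by
        intro a b hab p hp
        have h2 : (b : ℝ) < |p.2| := hp.2
        have h3 : (a : ℝ) ≤ b := by exact_mod_cast hab
        exact ⟨hp.1, h3.trans_lt h2⟩)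
      ⟨0, ((measure_mono Set.inter_subset_left).trans_lt (by rw [hvol]; exact ENNReal.ofReal_lt_top)).ne⟩
    have he : (⋂ n : ℕ, Ω ∩ {p : ℝ × ℝ | (n : ℝ) < |p.2|}) = ∅ := by
      ext p
      simp only [Set.mem_iInter, Set.mem_empty_iff_false, iff_false, not_forall]
      obtain ⟨n, hn⟩ := exists_nat_ge |p.2|
      exact ⟨n, fun h => absurd h.2 (not_lt.2 hn)⟩
    rw [he, measure_empty] at ht
    have := ht.eventually_lt_const (ENNReal.ofReal_pos.2 (show 0 < m / 4 by linarith))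
    obtain ⟨n, hn⟩ := this.exists
    exact ⟨n, hn.le⟩
  set T : ℝ := (n : ℝ) with hT
  have hT0 : 0 ≤ T := Nat.cast_nonneg n
  have hqT := qf_pos hl T
  set κ := 2 / lam * (1 - T / qf lam T) with hκ
  have hκ0 : 0 < κ := by
    have : T / qf lam T < 1 := by
      rw [div_lt_one hqT]; have := abs_lt_qf hl T; rwa [abs_of_nonneg hT0] at this
    have h2 : 0 < 1 - T / qf lam T := by linarith
    positivity
  set η := m / 8 * κ / (2 * (qf lam T * (2 * π))) with hη
  have hη0 : 0 < η := by positivity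
  refine ⟨η ^ 2 / qf lam T ^ 2 * (m / 8), by positivity, fun E hE hEΩ hEv c hc => ?_⟩
  set B : Set ℝ := {t | |t| ≤ T ∧ |Xcat lam c t| < η} with hB
  have hBm : MeasurableSet B :=
    MeasurableSet.inter (s₁ := {t : ℝ | |t| ≤ T}) (s₂ := {t : ℝ | |Xcat lam c t| < η})
      (measurableSet_le (continuous_abs.measurable) measurable_const)
      (measurableSet_lt ((hX c).abs).measurable measurable_const)
  have hBv : volume B ≤ ENNReal.ofReal (2 * η / κ) := by
    refine (Real.volume_le_diam B).trans (Metric.ediam_le_of_forall_dist_le ?_)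
    have aux : ∀ x ∈ B, ∀ y ∈ B, x ≤ y → y - x ≤ 2 * η / κ := by
      intro x hx y hy hxy
      have h := Xcat_diff hl hc hx.1 hy.1 hxy
      have a := (abs_lt.1 hx.2)
      have b := (abs_lt.1 hy.2)
      rw [le_div_iff₀ hκ0]
      linarith
    intro x hx y hy
    rw [Real.dist_eq]
    rcases le_total x y with h | h
    · rw [abs_sub_comm, abs_of_nonneg (by linarith)]; exact aux x hx y hy h
    · rw [abs_of_nonneg (by linarith)]; exact aux y hy x hx h
  have hqle : ∀ t, |t| ≤ T → qf lam t ≤ qf lam T := by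
    intro t ht
    refine Real.sqrt_le_sqrt ?_
    have : t ^ 2 ≤ T ^ 2 := sq_le_sq' (by linarith [neg_abs_le t]) ((le_abs_self t).trans ht)
    linarith
  have hBc : cvM lam (Prod.snd ⁻¹' B) ≤ ENNReal.ofReal (m / 8) := by
    rw [cvM_apply lam (measurable_snd hBm)]
    calc ∫⁻ p in Prod.snd ⁻¹' B, ENNReal.ofReal (qf lam p.2) ∂nuM
        ≤ ∫⁻ p in Prod.snd ⁻¹' B, ENNReal.ofReal (qf lam T) ∂nuM :=
          setLIntegral_mono' (measurable_snd hBm) (fun p hp => ENNReal.ofReal_le_ofReal (hqle _ hp.1))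
      _ = ENNReal.ofReal (qf lam T) * (ENNReal.ofReal (2 * π) * volume B) := by
          rw [setLIntegral_const, ← Set.univ_prod, nuM, Measure.prod_prod, Measure.restrict_apply_univ,
            Real.volume_Ioo]
          congr 3; ring
      _ ≤ ENNReal.ofReal (qf lam T) * (ENNReal.ofReal (2 * π) * ENNReal.ofReal (2 * η / κ)) := by
          gcongr
      _ = ENNReal.ofReal (m / 8) := by
          rw [← ENNReal.ofReal_mul (by positivity), ← ENNReal.ofReal_mul (by positivity)]
          congr 1
          rw [hη]
          field_simp
  set E' := E ∩ {p : ℝ × ℝ | |p.2| ≤ T ∧ η ≤ |Xcat lam c p.2|} with hE'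
  have hE'm : MeasurableSet E' := hE.inter
    (MeasurableSet.inter (s₁ := {p : ℝ × ℝ | |p.2| ≤ T}) (s₂ := {p : ℝ × ℝ | η ≤ |Xcat lam c p.2|})
      (measurableSet_le (continuous_snd.abs.measurable) measurable_const)
      (measurableSet_le measurable_const (((hX c).comp continuous_snd).abs).measurable))
  have hcov : E ⊆ (E' ∪ (Ω ∩ {p | (n : ℝ) < |p.2|})) ∪ Prod.snd ⁻¹' B := by
    intro p hp
    by_cases h1 : |p.2| ≤ T
    · by_cases h2 : η ≤ |Xcat lam c p.2|
      · exact Or.inl (Or.inl ⟨hp, h1, h2⟩)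
      · exact Or.inr ⟨h1, not_le.1 h2⟩
    · exact Or.inl (Or.inr ⟨hEΩ hp, not_le.1 h1⟩)
  have hE'v : ENNReal.ofReal (m / 8) ≤ cvM lam E' := by
    have h1 : ENNReal.ofReal (m / 2) ≤ cvM lam E' + ENNReal.ofReal (m / 4) + ENNReal.ofReal (m / 8) :=
      hEv.trans ((measure_mono hcov).trans ((measure_union_le _ _).trans
        (add_le_add ((measure_union_le _ _).trans (add_le_add le_rfl hn)) hBc)))
    rw [add_assoc, ← ENNReal.ofReal_add (by positivity) (by positivity)] at h1
    have h2 : ENNReal.ofReal (m / 2) = ENNReal.ofReal (m / 8) + ENNReal.ofReal (m / 4 + m / 8) := by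
      rw [← ENNReal.ofReal_add (by positivity) (by positivity)]; congr 1; ring
    rw [h2] at h1
    exact (ENNReal.add_le_add_iff_right ENNReal.ofReal_ne_top).1 h1
  calc ENNReal.ofReal (η ^ 2 / qf lam T ^ 2 * (m / 8))
      = ENNReal.ofReal (η ^ 2 / qf lam T ^ 2) * ENNReal.ofReal (m / 8) := ENNReal.ofReal_mul (by positivity)
    _ ≤ ENNReal.ofReal (η ^ 2 / qf lam T ^ 2) * cvM lam E' := by gcongr
    _ = ∫⁻ p in E', ENNReal.ofReal (η ^ 2 / qf lam T ^ 2) * ENNReal.ofReal (qf lam p.2) ∂nuM := by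
        rw [cvM_apply lam hE'm, lintegral_const_mul _ (qf_snd_meas lam)]
    _ ≤ ∫⁻ p in E', ENNReal.ofReal (Xcat lam c p.2 ^ 2 / qf lam p.2) ∂nuM := by
        refine setLIntegral_mono' hE'm (fun p hp => ?_)
        have hq := qf_pos hl p.2
        rw [← ENNReal.ofReal_mul (by positivity)]
        refine ENNReal.ofReal_le_ofReal ?_
        have h1 : η ^ 2 ≤ Xcat lam c p.2 ^ 2 := by
          rw [← sq_abs (Xcat lam c p.2)]
          exact pow_le_pow_left₀ hη0.le hp.2.2 2
        have h2 := hqle p.2 hp.2.1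
        rw [le_div_iff₀ hq, div_mul_eq_mul_div, div_mul_eq_mul_div, div_le_iff₀ (by positivity)]
        have h3 : qf lam p.2 * qf lam p.2 ≤ qf lam T ^ 2 := by nlinarith
        nlinarith [sq_nonneg η]
    _ ≤ _ := lintegral_mono_set Set.inter_subset_left

lemma amgm_limit {A B K : ℝ} (hA : 0 ≤ A) (hB : 0 ≤ B)
    (h : ∀ c : ℝ, 0 < c → K ≤ c ^ 2 * A + (c⁻¹) ^ 2 * B) : K ≤ 2 * (√A * √B) := by
  have h1 : ∀ ε : ℝ, 0 < ε → K ≤ 2 * (√(A + ε) * √(B + ε)) := by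
    intro ε hε
    have ha : 0 < √(A + ε) := Real.sqrt_pos.2 (by linarith)
    have hb : 0 < √(B + ε) := Real.sqrt_pos.2 (by linarith)
    have sa : √(A + ε) ^ 2 = A + ε := Real.sq_sqrt (by linarith)
    have sb : √(B + ε) ^ 2 = B + ε := Real.sq_sqrt (by linarith)
    have hx : 0 < √(B + ε) / √(A + ε) := by positivity
    have := h (√(√(B + ε) / √(A + ε))) (Real.sqrt_pos.2 hx)
    rw [inv_pow, Real.sq_sqrt hx.le, inv_div] at this
    refine this.trans ?_
    have h2 : √(B + ε) / √(A + ε) * A ≤ √(B + ε) / √(A + ε) * √(A + ε) ^ 2 :=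
      mul_le_mul_of_nonneg_left (by rw [sa]; linarith) hx.le
    have h3 : √(A + ε) / √(B + ε) * B ≤ √(A + ε) / √(B + ε) * √(B + ε) ^ 2 :=
      mul_le_mul_of_nonneg_left (by rw [sb]; linarith) (by positivity)
    have e2 : √(B + ε) / √(A + ε) * √(A + ε) ^ 2 = √(A + ε) * √(B + ε) := by field_simp
    have e3 : √(A + ε) / √(B + ε) * √(B + ε) ^ 2 = √(A + ε) * √(B + ε) := by field_simp
    linarith
  have hc : Continuous fun ε : ℝ => 2 * (√(A + ε) * √(B + ε)) := by fun_prop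
  have ht : Tendsto (fun ε : ℝ => 2 * (√(A + ε) * √(B + ε))) (𝓝[>] 0) (𝓝 (2 * (√A * √B))) := by
    have := (hc.tendsto 0).mono_left (nhdsWithin_le_nhds (s := Set.Ioi (0 : ℝ)))
    simpa using this
  refine ge_of_tendsto ht ?_
  filter_upwards [self_mem_nhdsWithin] with ε hε using h1 ε hε

def pf (m c a : ℝ) : ℝ := if a < m / 2 then 2 * √(π * a) else c * (2 * √(π * a))

/-- Sharp isoperimetric inequality on the catenoid with a gain for big sets. -/
theorem cat_iso {lam : ℝ} (hl : 0 < lam) {m : ℝ} (hm : 0 < m) {Ω : Set (ℝ × ℝ)} (hΩ : MeasurableSet Ω)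
    (hvol : cvM lam Ω = ENNReal.ofReal m) :
    ∃ c : ℝ, 1 < c ∧ ∀ U : ℝ × ℝ → ℝ, ContDiff ℝ 1 U → (∀ θ t, U (θ + 2 * π, t) = U (θ, t)) →
      ∀ T : ℝ, (∀ p : ℝ × ℝ, T ≤ |p.2| → U p = 0) → ∀ E : Set (ℝ × ℝ), MeasurableSet E → E ⊆ Ω →
      (∀ p ∈ E, 1 ≤ U p) →
      ENNReal.ofReal (pf m c ((cvM lam).real E)) ≤ ∫⁻ p, ENNReal.ofReal (GU lam U p) ∂cvM lam := by
  obtain ⟨δ, hδ0, hδ⟩ := gap hl hm hΩ hvol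
  refine ⟨√(1 + lam ^ 2 * δ / (4 * m)), ?_, fun U hU hper T hT E hE hEΩ hE1 => ?_⟩
  · rw [Real.lt_sqrt (by norm_num)]
    have : 0 < lam ^ 2 * δ / (4 * m) := by positivity
    linarith
  refine le_trans (ENNReal.ofReal_le_ofReal ?_) (full_iso hl hU hper hT hE hE1)
  set I1 := ∫⁻ p in E, ENNReal.ofReal (rf lam p.2 ^ 2 / qf lam p.2) ∂nuM with hI1
  set I2 := ∫⁻ p in E, ENNReal.ofReal (rf lam (-p.2) ^ 2 / qf lam p.2) ∂nuM with hI2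
  set I3 := ∫⁻ p in E, ENNReal.ofReal (1 / qf lam p.2) ∂nuM with hI3
  have hEm : cvM lam E ≤ ENNReal.ofReal m := hvol ▸ measure_mono hEΩ
  have hEfin : cvM lam E ≠ ∞ := (hEm.trans_lt ENNReal.ofReal_lt_top).ne
  have m1 : Measurable fun p : ℝ × ℝ => ENNReal.ofReal (rf lam p.2 ^ 2 / qf lam p.2) :=
    ENNReal.measurable_ofReal.comp ((((rf_continuous lam).comp continuous_snd).pow 2).measurable.div
      ((qf_continuous lam).comp continuous_snd).measurable)
  have m2 : Measurable fun p : ℝ × ℝ => ENNReal.ofReal (rf lam (-p.2) ^ 2 / qf lam p.2) :=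
    ENNReal.measurable_ofReal.comp ((((rf_continuous lam).comp continuous_snd.neg).pow 2).measurable.div
      ((qf_continuous lam).comp continuous_snd).measurable)
  have m3 : Measurable fun p : ℝ × ℝ => ENNReal.ofReal (1 / qf lam p.2) :=
    ENNReal.measurable_ofReal.comp (measurable_const.div
      ((qf_continuous lam).comp continuous_snd).measurable)
  have m12 : Measurable fun p : ℝ × ℝ => ENNReal.ofReal (rf lam p.2 ^ 2 / qf lam p.2) +
    ENNReal.ofReal (rf lam (-p.2) ^ 2 / qf lam p.2) := m1.add m2
  have hsum : I1 + I2 + 2 * I3 = ENNReal.ofReal (4 / lam ^ 2) * cvM lam E := by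
    rw [cvM_apply lam hE, ← lintegral_const_mul _ (qf_snd_meas lam), hI1, hI2, hI3,
      ← lintegral_const_mul _ m3, ← lintegral_add_left m1, ← lintegral_add_left m12]
    refine lintegral_congr fun p => ?_
    have hq := qf_pos hl p.2
    rw [← ENNReal.ofReal_add (by positivity) (by positivity), ← ENNReal.ofReal_mul (by positivity),
      show (2 : ℝ≥0∞) = ENNReal.ofReal 2 by simp, ← ENNReal.ofReal_mul (by positivity),
      ← ENNReal.ofReal_add (by positivity) (by positivity)]
    congr 1
    have a := rf_mul_neg hl p.2
    have b := rf_add_neg hl p.2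
    have : rf lam p.2 ^ 2 + rf lam (-p.2) ^ 2 + 2 = (2 * qf lam p.2 / lam) ^ 2 := by
      rw [← b]; linear_combination (-2) * a
    have e : rf lam p.2 ^ 2 / qf lam p.2 + rf lam (-p.2) ^ 2 / qf lam p.2 + 2 * (1 / qf lam p.2) =
        (rf lam p.2 ^ 2 + rf lam (-p.2) ^ 2 + 2) / qf lam p.2 := by ring
    rw [e, this]
    field_simp
    norm_num
  have hfin : I1 + I2 + 2 * I3 ≠ ∞ := by rw [hsum]; exact ENNReal.mul_ne_top ENNReal.ofReal_ne_top hEfin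
  have f1 : I1 ≠ ∞ := fun h => hfin (by simp [h])
  have f2 : I2 ≠ ∞ := fun h => hfin (by simp [h])
  have f3 : I3 ≠ ∞ := fun h => hfin (by simp [h])
  have hdec : ∀ c : ℝ, 0 < c → ENNReal.ofReal (c ^ 2) * I1 + ENNReal.ofReal ((c⁻¹) ^ 2) * I2 =
      2 * I3 + ∫⁻ p in E, ENNReal.ofReal (Xcat lam c p.2 ^ 2 / qf lam p.2) ∂nuM := by
    intro c hc
    rw [hI1, hI2, hI3, ← lintegral_const_mul _ m3, ← lintegral_const_mul _ m1, ← lintegral_const_mul _ m2,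
      ← lintegral_add_left (m1.const_mul _), ← lintegral_add_left (m3.const_mul _)]
    refine lintegral_congr fun p => ?_
    have hq := qf_pos hl p.2
    rw [← ENNReal.ofReal_mul (by positivity), ← ENNReal.ofReal_mul (by positivity),
      ← ENNReal.ofReal_add (by positivity) (by positivity),
      show (2 : ℝ≥0∞) = ENNReal.ofReal 2 by simp, ← ENNReal.ofReal_mul (by positivity),
      ← ENNReal.ofReal_add (by positivity) (by positivity)]
    congr 1
    have a := rf_mul_neg hl p.2
    unfold Xcat
    have hcc : c * c⁻¹ = 1 := mul_inv_cancel₀ hc.ne'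
    have : (c * rf lam p.2 - c⁻¹ * rf lam (-p.2)) ^ 2 =
        c ^ 2 * rf lam p.2 ^ 2 + (c⁻¹) ^ 2 * rf lam (-p.2) ^ 2 - 2 := by
      linear_combination (-2) * (rf lam p.2 * rf lam (-p.2)) * hcc - 2 * a
    rw [this]
    ring
  have hreal : ∀ c : ℝ, 0 < c → ∀ d : ℝ, 0 ≤ d →
      ENNReal.ofReal d ≤ ∫⁻ p in E, ENNReal.ofReal (Xcat lam c p.2 ^ 2 / qf lam p.2) ∂nuM →
      2 * I3.toReal + d ≤ c ^ 2 * I1.toReal + (c⁻¹) ^ 2 * I2.toReal := by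
    intro c hc d hd hle
    have h := (add_le_add (le_refl (2 * I3)) hle).trans (hdec c hc).ge
    have ft : ENNReal.ofReal (c ^ 2) * I1 + ENNReal.ofReal ((c⁻¹) ^ 2) * I2 ≠ ∞ :=
      ENNReal.add_ne_top.2 ⟨ENNReal.mul_ne_top ENNReal.ofReal_ne_top f1,
        ENNReal.mul_ne_top ENNReal.ofReal_ne_top f2⟩
    have h2 := ENNReal.toReal_mono ft h
    rw [ENNReal.toReal_add (ENNReal.mul_ne_top (by simp) f3) ENNReal.ofReal_ne_top,
      ENNReal.toReal_add (ENNReal.mul_ne_top ENNReal.ofReal_ne_top f1)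
        (ENNReal.mul_ne_top ENNReal.ofReal_ne_top f2), ENNReal.toReal_mul, ENNReal.toReal_mul,
      ENNReal.toReal_mul, ENNReal.toReal_ofReal hd, ENNReal.toReal_ofReal (by positivity),
      ENNReal.toReal_ofReal (by positivity)] at h2
    simpa using h2
  have hsumR : I1.toReal + I2.toReal + 2 * I3.toReal = 4 / lam ^ 2 * (cvM lam).real E := by
    have := congrArg ENNReal.toReal hsum
    rw [ENNReal.toReal_add (ENNReal.add_ne_top.2 ⟨f1, f2⟩) (ENNReal.mul_ne_top (by simp) f3),
      ENNReal.toReal_add f1 f2, ENNReal.toReal_mul, ENNReal.toReal_mul,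
      ENNReal.toReal_ofReal (by positivity)] at this
    simpa [measureReal_def] using this
  set a := (cvM lam).real E with ha
  have ha0 : 0 ≤ a := ENNReal.toReal_nonneg
  have ham : a ≤ m := by
    rw [ha, measureReal_def, ← ENNReal.toReal_ofReal hm.le]
    exact ENNReal.toReal_mono ENNReal.ofReal_ne_top hEm
  set x := √I1.toReal with hx
  set y := √I2.toReal with hy
  have hx0 : 0 ≤ x := Real.sqrt_nonneg _
  have hy0 : 0 ≤ y := Real.sqrt_nonneg _
  have hx2 : x ^ 2 = I1.toReal := Real.sq_sqrt ENNReal.toReal_nonneg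
  have hy2 : y ^ 2 = I2.toReal := Real.sq_sqrt ENNReal.toReal_nonneg
  have main : ∀ d : ℝ, 0 ≤ d → 2 * I3.toReal + d ≤ 2 * (x * y) →
      √(4 * π * a + π * lam ^ 2 * d) ≤ lam * √π * (x + y) := by
    intro d hd h
    rw [Real.sqrt_le_iff]
    refine ⟨by positivity, ?_⟩
    rw [mul_pow, mul_pow, Real.sq_sqrt Real.pi_pos.le]
    have h2 : 4 / lam ^ 2 * a + d ≤ (x + y) ^ 2 := by rw [← hsumR, ← hx2, ← hy2]; nlinarith
    have h3 := mul_le_mul_of_nonneg_left h2 (show 0 ≤ lam ^ 2 * π by positivity)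
    refine le_trans (le_of_eq ?_) h3
    field_simp
  have hs4 : ∀ r : ℝ, 0 ≤ r → 2 * √r = √(4 * r) := by
    intro r hr
    rw [Real.sqrt_mul (by norm_num), show (4 : ℝ) = 2 ^ 2 by norm_num, Real.sqrt_sq (by norm_num)]
  unfold pf
  split_ifs with hcase
  · have h0 : 2 * I3.toReal + 0 ≤ 2 * (x * y) := amgm_limit ENNReal.toReal_nonneg ENNReal.toReal_nonneg
      (fun c hc => hreal c hc 0 le_rfl (by simp))
    refine le_trans (le_of_eq ?_) (main 0 le_rfl h0)
    rw [hs4 _ (by positivity)]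
    congr 1
    ring
  · push Not at hcase
    have hEv : ENNReal.ofReal (m / 2) ≤ cvM lam E := by
      rw [← ENNReal.ofReal_toReal hEfin]
      exact ENNReal.ofReal_le_ofReal hcase
    have h0 : 2 * I3.toReal + δ ≤ 2 * (x * y) := amgm_limit ENNReal.toReal_nonneg ENNReal.toReal_nonneg
      (fun c hc => hreal c hc δ hδ0.le (hδ E hE hEΩ hEv c hc))
    refine le_trans ?_ (main δ hδ0.le h0)
    rw [hs4 _ (by positivity), ← Real.sqrt_mul (by positivity)]
    refine Real.sqrt_le_sqrt ?_
    have : lam ^ 2 * δ / (4 * m) * (4 * (π * a)) ≤ π * lam ^ 2 * δ := by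
      rw [div_mul_eq_mul_div, div_le_iff₀ (by positivity)]
      have := mul_le_mul_of_nonneg_left ham (show 0 ≤ lam ^ 2 * δ * 4 * π by positivity)
      linarith
    linarith

end PartD2


section PartE

open MeasureTheory
open scoped ENNReal

lemma discFK {α : Type*} [MeasurableSpace α] {μ : Measure α} {u g : α → ℝ} (hu : Measurable u)
    (hiu : Integrable (fun x => u x ^ 2) μ)
    (hig : Integrable (fun x => g x ^ 2) μ) (hiug : Integrable (fun x => 2 * (|u x| * g x)) μ)
    {M : ℝ} (hM0 : 0 < M) (hM : ∀ x, u x ^ 2 ≤ M) {m : ℝ} (hm : 0 < m)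
    (hfin : μ {x | 0 < u x ^ 2} ≤ ENNReal.ofReal m)
    (p h : ℝ → ℝ) {κ K : ℝ} (hκ : 0 ≤ κ) (hp0 : p 0 = 0)
    (hh : ∀ a, 0 ≤ a → a ≤ m → 0 ≤ h a ∧ h a ^ 2 ≤ K)
    (hH : ∀ a b, 0 ≤ a → a ≤ b → b ≤ m → (κ + h a ^ 2) * (b - a) ≤ p b * h b - p a * h a)
    (slab : ∀ s1 s2, 0 ≤ s1 → s1 < s2 → (s2 - s1) * p (μ.real {x | s2 < u x ^ 2}) ≤
      ∫ x in {x | s1 < u x ^ 2} \ {x | s2 < u x ^ 2}, 2 * (|u x| * g x) ∂μ) :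
    κ * ∫ x, u x ^ 2 ∂μ ≤ ∫ x, g x ^ 2 ∂μ := by
  have hms : ∀ s : ℝ, MeasurableSet {x | s < u x ^ 2} := fun s =>
    measurableSet_lt measurable_const (hu.pow_const 2)
  have hmsub : ∀ s : ℝ, 0 ≤ s → μ {x | s < u x ^ 2} ≤ ENNReal.ofReal m := fun s hs =>
    (measure_mono fun x (hx : s < u x ^ 2) => show 0 < u x ^ 2 from hs.trans_lt hx).trans hfin
  have hAm : ∀ s : ℝ, 0 ≤ s → μ.real {x | s < u x ^ 2} ≤ m := fun s hs =>
    ENNReal.toReal_le_of_le_ofReal hm.le (hmsub s hs)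
  have hAf : ∀ s : ℝ, 0 ≤ s → μ {x | s < u x ^ 2} ≠ ⊤ := fun s hs =>
    ((hmsub s hs).trans_lt ENNReal.ofReal_lt_top).ne
  have step : ∀ s Δ : ℝ, 0 ≤ s → 0 < Δ →
      (∫ x in {x | s + Δ < u x ^ 2}, g x ^ 2 ∂μ) +
        (s + Δ) * (p (μ.real {x | s + Δ < u x ^ 2}) * h (μ.real {x | s + Δ < u x ^ 2})) -
        κ * (∫ x in {x | s + Δ < u x ^ 2}, u x ^ 2 ∂μ) +
        Δ * (κ + K) * μ.real {x | s + Δ < u x ^ 2} ≤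
      (∫ x in {x | s < u x ^ 2}, g x ^ 2 ∂μ) +
        s * (p (μ.real {x | s < u x ^ 2}) * h (μ.real {x | s < u x ^ 2})) -
        κ * (∫ x in {x | s < u x ^ 2}, u x ^ 2 ∂μ) +
        Δ * (κ + K) * μ.real {x | s < u x ^ 2} := by
    intro s Δ hs hΔ
    have hsub : {x | s + Δ < u x ^ 2} ⊆ {x | s < u x ^ 2} := fun x (hx : s + Δ < u x ^ 2) =>
      show s < u x ^ 2 by linarith
    set A := μ.real {x | s < u x ^ 2} with hA
    set B := μ.real {x | s + Δ < u x ^ 2} with hB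
    have hB0 : 0 ≤ B := measureReal_nonneg
    have hBA : B ≤ A := measureReal_mono hsub (hAf s hs)
    have hAm' : A ≤ m := hAm s hs
    have hs' : 0 ≤ s + Δ := by linarith
    have d1 := setIntegral_sdiff (μ := μ) (hms (s + Δ)) (hig.integrableOn (s := {x | s < u x ^ 2})) hsub
    have d2 := setIntegral_sdiff (μ := μ) (hms (s + Δ)) (hiu.integrableOn (s := {x | s < u x ^ 2})) hsub
    have d3 : μ.real ({x | s < u x ^ 2} \ {x | s + Δ < u x ^ 2}) = A - B :=
      measureReal_sdiff hsub (hms _) (hAf s hs)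
    set S := {x | s < u x ^ 2} \ {x | s + Δ < u x ^ 2} with hS
    have hSm : MeasurableSet S := (hms _).diff (hms _)
    have hSf : μ S ≠ ⊤ := ((measure_mono Set.sdiff_subset).trans_lt (hAf s hs).lt_top).ne
    have k1 : ∫ x in S, u x ^ 2 ∂μ ≤ (s + Δ) * (A - B) := by
      have : ∫ x in S, u x ^ 2 ∂μ ≤ ∫ x in S, (s + Δ) ∂μ := by
        refine setIntegral_mono_on hiu.integrableOn (integrableOn_const hSf) hSm ?_
        intro x hx
        exact not_lt.1 hx.2
      rw [setIntegral_const, d3, smul_eq_mul] at this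
      linarith
    obtain ⟨hh0, hhK⟩ := hh B hB0 (hBA.trans hAm')
    have k2 : h B * (Δ * p B) - h B ^ 2 * ∫ x in S, u x ^ 2 ∂μ ≤ ∫ x in S, g x ^ 2 ∂μ := by
      have sl := slab s (s + Δ) hs (by linarith)
      rw [add_sub_cancel_left] at sl
      have : ∫ x in S, (h B * (2 * (|u x| * g x)) - h B ^ 2 * u x ^ 2) ∂μ ≤ ∫ x in S, g x ^ 2 ∂μ := by
        refine setIntegral_mono_on ((hiug.const_mul _).sub (hiu.const_mul _)).integrableOn
          hig.integrableOn hSm ?_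
        intro x hx
        have := sq_nonneg (g x - h B * |u x|)
        have e : |u x| ^ 2 = u x ^ 2 := sq_abs _
        nlinarith
      rw [integral_sub (hiug.const_mul _).integrableOn (hiu.const_mul _).integrableOn,
        integral_const_mul (h B), integral_const_mul (h B ^ 2)] at this
      have := mul_le_mul_of_nonneg_left sl hh0
      linarith
    have k3 := hH B A hB0 hBA hAm'
    have k4 := mul_le_mul_of_nonneg_left k3 hs
    have k5 := mul_le_mul_of_nonneg_left k1 (show 0 ≤ κ + h B ^ 2 by positivity)
    have k6 : Δ * (h B ^ 2 * (A - B)) ≤ Δ * (K * (A - B)) :=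
      mul_le_mul_of_nonneg_left (mul_le_mul_of_nonneg_right hhK (by linarith)) hΔ.le
    nlinarith
  have key : ∀ n : ℕ, κ * ∫ x, u x ^ 2 ∂μ ≤
      ∫ x, g x ^ 2 ∂μ + (κ + K) * μ.real {x | 0 < u x ^ 2} * M * (1 / ((n : ℝ) + 1)) := by
    intro n
    set Δ := M / ((n : ℝ) + 1) with hΔ
    have hΔ0 : 0 < Δ := by positivity
    let f : ℕ → ℝ := fun i => (∫ x in {x | (i : ℝ) * Δ < u x ^ 2}, g x ^ 2 ∂μ) +
        ((i : ℝ) * Δ) * (p (μ.real {x | (i : ℝ) * Δ < u x ^ 2}) * h (μ.real {x | (i : ℝ) * Δ < u x ^ 2})) -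
        κ * (∫ x in {x | (i : ℝ) * Δ < u x ^ 2}, u x ^ 2 ∂μ) +
        Δ * (κ + K) * μ.real {x | (i : ℝ) * Δ < u x ^ 2}
    have hf : Antitone f := by
      refine antitone_nat_of_succ_le fun i => ?_
      have := step ((i : ℝ) * Δ) Δ (by positivity) hΔ0
      have e : ((i + 1 : ℕ) : ℝ) * Δ = (i : ℝ) * Δ + Δ := by push_cast; ring
      simp only [f, e]
      exact this
    have h0 := hf (Nat.zero_le (n + 1))
    have e1 : ((n + 1 : ℕ) : ℝ) * Δ = M := by
      rw [hΔ]; push_cast; field_simp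
    have e2 : {x | M < u x ^ 2} = ∅ := by
      ext x; simpa using hM x
    simp only [f, e1, e2] at h0
    simp only [Measure.restrict_empty, integral_zero_measure, measureReal_empty, hp0, Nat.cast_zero,
      zero_mul, mul_zero, add_zero, sub_zero] at h0
    have e3 : ∫ x in {x | 0 < u x ^ 2}, u x ^ 2 ∂μ = ∫ x, u x ^ 2 ∂μ := by
      refine setIntegral_eq_integral_of_forall_compl_eq_zero ?_
      intro x hx
      exact le_antisymm (not_lt.1 hx) (sq_nonneg _)
    have e4 : ∫ x in {x | 0 < u x ^ 2}, g x ^ 2 ∂μ ≤ ∫ x, g x ^ 2 ∂μ :=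
      setIntegral_le_integral hig (Eventually.of_forall fun x => sq_nonneg _)
    rw [e3] at h0
    have e5 : (κ + K) * μ.real {x | 0 < u x ^ 2} * M * (1 / ((n : ℝ) + 1)) =
      Δ * (κ + K) * μ.real {x | 0 < u x ^ 2} := by rw [hΔ]; field_simp
    rw [e5]
    linarith
  have lim : Tendsto (fun n : ℕ => ∫ x, g x ^ 2 ∂μ +
      (κ + K) * μ.real {x | 0 < u x ^ 2} * M * (1 / ((n : ℝ) + 1))) atTop
      (𝓝 (∫ x, g x ^ 2 ∂μ + (κ + K) * μ.real {x | 0 < u x ^ 2} * M * 0)) :=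
    (tendsto_one_div_add_atTop_nhds_zero_nat.const_mul _).const_add _
  rw [mul_zero, add_zero] at lim
  exact ge_of_tendsto' lim key

lemma exists_h {m c : ℝ} (hm : 0 < m) (hc : 1 < c) : ∃ κ K : ℝ, ∃ h : ℝ → ℝ, π * y0 / m < κ ∧
    (∀ a, 0 ≤ a → a ≤ m → 0 ≤ h a ∧ h a ^ 2 ≤ K) ∧
    (∀ a b, 0 ≤ a → a ≤ b → b ≤ m →
      (κ + h a ^ 2) * (b - a) ≤ pf m c b * h b - pf m c a * h a) := by
  have hc0 : 0 < c := by linarith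
  have hy := y0_pos
  have hi : 1 / c < 1 := by rw [div_lt_one hc0]; exact hc
  have hi0 : 0 < 1 / c := by positivity
  set m' := m * (3 + 1 / c) / 4 with hm'
  have hm'0 : 0 < m' := by positivity
  have hm'm : m' < m := by rw [hm']; nlinarith
  have hm'2 : m / 2 + m / 2 / c < m' := by
    have : m / 2 / c = m / 2 * (1 / c) := by ring
    rw [this, hm']; nlinarith
  set k := y0 / m' with hk
  have hk0 : 0 < k := by positivity
  have hkm : k * m' = y0 := by rw [hk]; field_simp
  let Y : ℝ → ℝ := fun a => if a < m / 2 then k * a else k * (m / 2 + (a - m / 2) / c)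
  have hY1 : ∀ a, a < m / 2 → Y a = k * a := fun a h => if_pos h
  have hY2 : ∀ a, m / 2 ≤ a → Y a = k * (m / 2 + (a - m / 2) / c) := fun a h => if_neg (not_lt.2 h)
  have hYle : ∀ a, Y a ≤ k * a := by
    intro a
    rcases lt_or_ge a (m / 2) with h | h
    · rw [hY1 a h]
    · rw [hY2 a h]
      refine mul_le_mul_of_nonneg_left ?_ hk0.le
      have : (a - m / 2) / c ≤ a - m / 2 := div_le_self (by linarith) hc.le
      linarith
  have hY0 : ∀ a, 0 ≤ a → 0 ≤ Y a := by
    intro a ha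
    rcases lt_or_ge a (m / 2) with h | h
    · rw [hY1 a h]; positivity
    · rw [hY2 a h]
      have : 0 ≤ (a - m / 2) / c := div_nonneg (by linarith) hc0.le
      positivity
  -- growth of Y
  have hYg1 : ∀ a b, a ≤ b → k * (b - a) ≤ c * (Y b - Y a) := by
    intro a b hab
    rcases lt_or_ge a (m / 2) with ha | ha
    · rw [hY1 a ha]
      rcases lt_or_ge b (m / 2) with hb | hb
      · rw [hY1 b hb]
        have : 0 ≤ k * (b - a) := mul_nonneg hk0.le (by linarith)
        nlinarith
      · rw [hY2 b hb]
        have e : c * (k * (m / 2 + (b - m / 2) / c) - k * a) = k * (c * (m / 2 - a) + (b - m / 2)) := by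
          field_simp; ring
        rw [e]
        refine mul_le_mul_of_nonneg_left ?_ hk0.le
        nlinarith
    · rw [hY2 a ha, hY2 b (ha.trans hab)]
      refine le_of_eq ?_
      field_simp; ring
  have hYmono : ∀ a b, a ≤ b → Y a ≤ Y b := by
    intro a b hab
    have h1 := hYg1 a b hab
    have h2 : 0 ≤ k * (b - a) := mul_nonneg hk0.le (by linarith)
    have h3 : 0 ≤ c * (Y b - Y a) := h2.trans h1
    have := nonneg_of_mul_nonneg_right h3 hc0
    linarith
  have hYm : Y m < y0 := by
    rw [hY2 m (by linarith), ← hkm]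
    refine mul_lt_mul_of_pos_left ?_ hk0
    have : m - m / 2 = m / 2 := by ring
    rw [this]; exact hm'2
  have hYlt : ∀ a, a ≤ m → Y a < y0 := fun a ha => (hYmono a m ha).trans_lt hYm
  let h : ℝ → ℝ := fun a => Qf (Y a) / (2 * √(π * a))
  have hsq : ∀ a, 0 ≤ a → a ≤ m → h a ^ 2 ≤ k * Rf (Y a) := by
    intro a ha ham
    rcases ha.eq_or_lt with rfl | hpos
    · have e : h 0 = 0 := by simp [h]
      rw [e, zero_pow two_ne_zero]
      exact mul_nonneg hk0.le (Rf_nonneg (hY0 0 le_rfl))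
    · have hR := Rf_nonneg (hY0 a ha)
      simp only [h]
      rw [div_pow, Qf_sq (hY0 a ha) (hYlt a ham), mul_pow, Real.sq_sqrt (by positivity), div_le_iff₀ (by positivity)]
      have := mul_le_mul_of_nonneg_right (hYle a) hR
      have h2 := mul_le_mul_of_nonneg_left this (show 0 ≤ 4 * π by positivity)
      linarith
  have hP1 : ∀ a, 0 ≤ a → a < m / 2 → pf m c a * h a = Qf (Y a) := by
    intro a ha h2
    unfold pf
    rw [if_pos h2]
    rcases ha.eq_or_lt with rfl | hpos
    · rw [hY1 0 h2, mul_zero, mul_zero, Qf_zero]; simp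
    · have : 0 < √(π * a) := Real.sqrt_pos.2 (by positivity)
      simp only [h]
      field_simp
  have hP2 : ∀ a, m / 2 ≤ a → pf m c a * h a = c * Qf (Y a) := by
    intro a h2
    unfold pf
    rw [if_neg (not_lt.2 h2)]
    have : 0 < √(π * a) := Real.sqrt_pos.2 (mul_pos Real.pi_pos (by linarith))
    simp only [h]
    field_simp
  refine ⟨k * π, k * Rf (Y m), h, ?_, ?_, ?_⟩
  · rw [hk, div_mul_eq_mul_div, mul_comm y0]
    exact div_lt_div_of_pos_left (by positivity) hm'0 hm'm
  · intro a ha ham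
    refine ⟨div_nonneg (Qf_nonneg (hY0 a ha) (hYlt a ham)) (by positivity), (hsq a ha ham).trans ?_⟩
    refine mul_le_mul_of_nonneg_left ?_ hk0.le
    exact Rf_mono ⟨hY0 a ha, hYlt a ham⟩ ⟨hY0 m hm.le, hYm⟩ (hYmono a m ham)
  · intro a b ha hab hbm
    have hb : 0 ≤ b := ha.trans hab
    have t := Qf_tangent (hY0 a ha) (hYmono a b hab) (hYlt b hbm)
    have hR := Rf_nonneg (hY0 a ha)
    have hs := hsq a ha (hab.trans hbm)
    have hπ := Real.pi_pos
    have l1 : (k * π + h a ^ 2) * (b - a) ≤ (π + Rf (Y a)) * (k * (b - a)) := by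
      have := mul_le_mul_of_nonneg_right hs (show 0 ≤ b - a by linarith)
      linarith
    rcases lt_or_ge b (m / 2) with hb2 | hb2
    · rw [hP1 b hb hb2, hP1 a ha (by linarith)]
      have e : Y b - Y a = k * (b - a) := by rw [hY1 b hb2, hY1 a (by linarith)]; ring
      rw [e] at t
      linarith
    · have l2 := mul_le_mul_of_nonneg_left (hYg1 a b hab) (show 0 ≤ π + Rf (Y a) by positivity)
      have l3 := mul_le_mul_of_nonneg_left t hc0.le
      rw [hP2 b hb2]
      rcases lt_or_ge a (m / 2) with ha2 | ha2
      · rw [hP1 a ha ha2]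
        have := Qf_nonneg (hY0 a ha) (hYlt a (hab.trans hbm))
        nlinarith
      · rw [hP2 a ha2]
        linarith


end PartE

section PartE2

open MeasureTheory
open scoped ENNReal

/-- continuous cutoff profile on the interval `[s1, s2]`. -/
def tau (s1 s2 N s : ℝ) : ℝ := min 1 (N * max 0 (min (s - s1) (s2 - s)))

lemma tau_continuous (s1 s2 N : ℝ) : Continuous (tau s1 s2 N) := by
  unfold tau; fun_prop

lemma tau_nonneg {s1 s2 N : ℝ} (hN : 0 ≤ N) (s : ℝ) : 0 ≤ tau s1 s2 N s :=
  le_min zero_le_one (mul_nonneg hN (le_max_left _ _))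

lemma tau_le_one (s1 s2 N s : ℝ) : tau s1 s2 N s ≤ 1 := min_le_left _ _

lemma tau_zero_left {s1 s2 N s : ℝ} (h : s ≤ s1) : tau s1 s2 N s = 0 := by
  unfold tau
  rw [max_eq_left ((min_le_left _ _).trans (by linarith)), mul_zero, min_eq_right zero_le_one]

lemma tau_zero_right {s1 s2 N s : ℝ} (h : s2 ≤ s) : tau s1 s2 N s = 0 := by
  unfold tau
  rw [max_eq_left ((min_le_right _ _).trans (by linarith)), mul_zero, min_eq_right zero_le_one]

def ptau (s1 s2 N x : ℝ) : ℝ := ∫ s in s1..x, tau s1 s2 N s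

lemma ptau_deriv (s1 s2 N x : ℝ) : HasDerivAt (ptau s1 s2 N) (tau s1 s2 N x) x :=
  intervalIntegral.integral_hasDerivAt_right ((tau_continuous _ _ _).intervalIntegrable _ _)
    ((tau_continuous _ _ _).stronglyMeasurableAtFilter _ _) (tau_continuous _ _ _).continuousAt

lemma ptau_contDiff (s1 s2 N : ℝ) : ContDiff ℝ 1 (ptau s1 s2 N) := by
  rw [contDiff_one_iff_deriv]
  refine ⟨fun x => (ptau_deriv s1 s2 N x).differentiableAt, ?_⟩
  have : deriv (ptau s1 s2 N) = tau s1 s2 N := funext fun x => (ptau_deriv s1 s2 N x).deriv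
  rw [this]
  exact tau_continuous _ _ _

lemma ptau_zero {s1 s2 N x : ℝ} (h : x ≤ s1) : ptau s1 s2 N x = 0 := by
  unfold ptau
  rw [intervalIntegral.integral_symm, neg_eq_zero]
  have : ∫ s in x..s1, tau s1 s2 N s = ∫ s in x..s1, (0 : ℝ) := by
    refine intervalIntegral.integral_congr fun s hs => ?_
    rw [Set.uIcc_of_le h] at hs
    exact tau_zero_left hs.2
  rw [this, intervalIntegral.integral_zero]

lemma ptau_mono {s1 s2 N : ℝ} (hN : 0 ≤ N) : Monotone (ptau s1 s2 N) :=
  monotone_of_deriv_nonneg (fun x => (ptau_deriv s1 s2 N x).differentiableAt)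
    fun x => by rw [(ptau_deriv s1 s2 N x).deriv]; exact tau_nonneg hN x

lemma ptau_ge {s1 s2 δ : ℝ} (hδ : 0 < δ) (h : s1 + 2 * δ < s2) :
    s2 - s1 - 2 * δ ≤ ptau s1 s2 (1 / δ) s2 := by
  have hN : 0 ≤ 1 / δ := by positivity
  have hi : ∀ a b, IntervalIntegrable (tau s1 s2 (1 / δ)) volume a b := fun a b =>
    (tau_continuous _ _ _).intervalIntegrable _ _
  have e : ∫ s in (s1 + δ)..(s2 - δ), tau s1 s2 (1 / δ) s = s2 - s1 - 2 * δ := by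
    have : ∫ s in (s1 + δ)..(s2 - δ), tau s1 s2 (1 / δ) s = ∫ s in (s1 + δ)..(s2 - δ), (1 : ℝ) := by
      refine intervalIntegral.integral_congr fun s hs => ?_
      rw [Set.uIcc_of_le (by linarith)] at hs
      unfold tau
      refine min_eq_left ?_
      have h1 : δ ≤ max 0 (min (s - s1) (s2 - s)) :=
        le_max_of_le_right (le_min (by linarith [hs.1]) (by linarith [hs.2]))
      rw [div_mul_eq_mul_div, one_mul, le_div_iff₀ hδ]
      linarith
    rw [this, intervalIntegral.integral_const, smul_eq_mul]; ring
  have s := intervalIntegral.integral_add_adjacent_intervals (hi s1 (s1 + δ)) (hi (s1 + δ) (s2 - δ))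
  have s' := intervalIntegral.integral_add_adjacent_intervals (hi s1 (s2 - δ)) (hi (s2 - δ) s2)
  have p1 : 0 ≤ ∫ s in s1..(s1 + δ), tau s1 s2 (1 / δ) s :=
    intervalIntegral.integral_nonneg (by linarith) fun x _ => tau_nonneg hN x
  have p2 : 0 ≤ ∫ s in (s2 - δ)..s2, tau s1 s2 (1 / δ) s :=
    intervalIntegral.integral_nonneg (by linarith) fun x _ => tau_nonneg hN x
  unfold ptau
  linarith

lemma GU_smul (lam : ℝ) {V U : ℝ × ℝ → ℝ} {p : ℝ × ℝ} {k : ℝ}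
    (h : ∀ v, fderiv ℝ V p v = k * fderiv ℝ U p v) : GU lam V p = |k| * GU lam U p := by
  unfold GU
  rw [h, h, ← Real.sqrt_sq_eq_abs, ← Real.sqrt_mul (sq_nonneg _)]
  congr 1
  ring

lemma cvM_integrable {lam : ℝ} (hl : 0 < lam) {F : ℝ × ℝ → ℝ} (hF : Continuous F) {T : ℝ}
    (hT : ∀ p : ℝ × ℝ, T ≤ |p.2| → F p = 0) : Integrable F (cvM lam) := by
  unfold cvM
  rw [integrable_withDensity_iff_integrable_smul' (qf_snd_meas lam)
    (Eventually.of_forall fun _ => ENNReal.ofReal_lt_top)]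
  have e : nuM = (volume : Measure (ℝ × ℝ)).restrict (Set.Ioo (-π) π ×ˢ Set.univ) := by
    unfold nuM
    rw [Measure.volume_eq_prod, ← Measure.prod_restrict, Measure.restrict_univ]
  rw [e]
  have hc : Continuous fun p : ℝ × ℝ => (ENNReal.ofReal (qf lam p.2)).toReal • F p := by
    have : (fun p : ℝ × ℝ => (ENNReal.ofReal (qf lam p.2)).toReal • F p) =
        fun p => qf lam p.2 * F p := by
      funext p
      rw [ENNReal.toReal_ofReal (qf_pos hl _).le, smul_eq_mul]
    rw [this]
    exact ((qf_continuous lam).comp continuous_snd).mul hF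
  have hK : IsCompact (Set.Icc (-π) π ×ˢ Set.Icc (-T) T : Set (ℝ × ℝ)) := isCompact_Icc.prod isCompact_Icc
  refine IntegrableOn.of_forall_sdiff_eq_zero (hc.continuousOn.integrableOn_compact hK)
    (measurableSet_Ioo.prod MeasurableSet.univ) ?_
  rintro ⟨a, b⟩ ⟨h1, h2⟩
  have : F (a, b) = 0 := by
    refine hT _ ?_
    by_contra hcon
    push Not at hcon
    have := abs_lt.1 hcon
    exact h2 ⟨⟨h1.1.1.le, h1.1.2.le⟩, ⟨this.1.le, this.2.le⟩⟩
  rw [this, smul_zero]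

lemma lifted_FK {lam m : ℝ} (hl : 0 < lam) (hm : 0 < m) {Ω : Set (ℝ × ℝ)} (hΩ : MeasurableSet Ω)
    (hvol : cvM lam Ω = ENNReal.ofReal m) :
    ∃ κ, π * y0 / m < κ ∧ ∀ U : ℝ × ℝ → ℝ, ContDiff ℝ 1 U →
      (∀ θ t, U (θ + 2 * π, t) = U (θ, t)) → ∀ T, (∀ p : ℝ × ℝ, T ≤ |p.2| → U p = 0) →
      (∃ M, ∀ p, U p ^ 2 ≤ M) →
      (∀ p, U p ≠ 0 → p ∈ Ω) →
      κ * ∫ p, U p ^ 2 ∂cvM lam ≤ ∫ p, GU lam U p ^ 2 ∂cvM lam := by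
  obtain ⟨c, hc, iso⟩ := cat_iso hl hm hΩ hvol
  obtain ⟨κ, K, h, hκ, hh, hH⟩ := exists_h hm hc
  have hy := y0_pos
  refine ⟨κ, hκ, ?_⟩
  rintro U hU hper T hT ⟨M, hM⟩ hsupp
  have hκ0 : 0 ≤ κ := le_trans (by positivity) hκ.le
  have hUc := hU.continuous
  have hGc := GU_continuous hl hU
  have hG0 : ∀ p, 0 ≤ GU lam U p := fun p => Real.sqrt_nonneg _
  have hGT : ∀ p : ℝ × ℝ, T + 1 ≤ |p.2| → GU lam U p = 0 := by
    intro p hp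
    have hev : U =ᶠ[𝓝 p] fun _ => (0 : ℝ) := by
      have : {q : ℝ × ℝ | T < |q.2|} ∈ 𝓝 p :=
        (isOpen_lt continuous_const (continuous_snd.abs)).mem_nhds (show T < |p.2| by linarith)
      filter_upwards [this] with q hq
      exact hT q (le_of_lt hq)
    have := hev.fderiv_eq (𝕜 := ℝ)
    unfold GU
    rw [this]
    simp
  have iu : Integrable (fun p => U p ^ 2) (cvM lam) :=
    cvM_integrable hl (hUc.pow 2) (T := T) fun p hp => by simp [hT p hp]
  have ig : Integrable (fun p => GU lam U p ^ 2) (cvM lam) :=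
    cvM_integrable hl (hGc.pow 2) (T := T + 1) fun p hp => by simp [hGT p hp]
  have iug : Integrable (fun p => 2 * (|U p| * GU lam U p)) (cvM lam) :=
    cvM_integrable hl (continuous_const.mul (hUc.abs.mul hGc)) (T := T) fun p hp => by simp [hT p hp]
  have hsq : ∀ p, 0 < U p ^ 2 → p ∈ Ω := fun p hp => hsupp p fun h0 => by simp [h0] at hp
  have hms : ∀ s : ℝ, MeasurableSet {x | s < U x ^ 2} := fun s =>
    measurableSet_lt measurable_const (hUc.pow 2).measurable
  refine discFK hUc.measurable iu ig iug (M := |M| + 1) (by positivity)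
    (fun p => (hM p).trans ((le_abs_self M).trans (by linarith))) hm ?_ (pf m c) h hκ0 ?_ hh hH ?_
  · rw [← hvol]
    exact measure_mono fun p hp => hsq p hp
  · unfold pf
    rw [if_pos (by positivity)]; simp
  intro s1 s2 hs1 h12
  set S := {x | s1 < U x ^ 2} \ {x | s2 < U x ^ 2} with hS
  have hSm : MeasurableSet S := (hms _).diff (hms _)
  set E := {x | s2 < U x ^ 2} with hE
  set P := pf m c ((cvM lam).real E) with hP
  set J := ∫ x in S, 2 * (|U x| * GU lam U x) ∂cvM lam with hJ
  have hJ0 : 0 ≤ J := integral_nonneg fun x => by have := hG0 x; positivity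
  have main : ∀ δ, 0 < δ → s1 + 2 * δ < s2 → (s2 - s1 - 2 * δ) * P ≤ J := by
    intro δ hδ hδ2
    have hN : 0 ≤ 1 / δ := by positivity
    have hI := ptau_ge hδ hδ2
    set I := ptau s1 s2 (1 / δ) s2 with hIdef
    have hI0 : 0 < I := by linarith
    let V : ℝ × ℝ → ℝ := fun p => I⁻¹ * ptau s1 s2 (1 / δ) (U p ^ 2)
    have hV : ContDiff ℝ 1 V := contDiff_const.mul ((ptau_contDiff _ _ _).comp (hU.pow 2))
    have hVd : ∀ p v, fderiv ℝ V p v =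
        (I⁻¹ * (tau s1 s2 (1 / δ) (U p ^ 2) * (2 * U p))) * fderiv ℝ U p v := by
      intro p v
      have hd : HasFDerivAt U (fderiv ℝ U p) p :=
        (hU.differentiable (by norm_num) p).hasFDerivAt
      have h1 := ((ptau_deriv s1 s2 (1 / δ) (U p ^ 2)).comp_hasFDerivAt p (hd.pow 2)).const_mul I⁻¹
      have h2 : fderiv ℝ V p = _ := h1.fderiv
      rw [h2]
      simp
      ring
    have key := iso V hV (fun θ t => by simp only [V]; rw [hper]) T
      (fun p hp => by simp only [V]; rw [hT p hp, ptau_zero (by simpa using hs1), mul_zero]) E (hms _)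
      (fun p hp => hsq p ((hs1.trans h12.le).trans_lt hp))
      (fun p hp => by
        simp only [V]
        rw [inv_mul_eq_div, one_le_div hI0]
        exact ptau_mono hN (le_of_lt hp))
    have hGV : ∀ p, GU lam V p ≤ I⁻¹ * S.indicator (fun x => 2 * (|U x| * GU lam U x)) p := by
      intro p
      rw [GU_smul lam (hVd p), abs_mul, abs_of_pos (inv_pos.2 hI0), mul_assoc]
      refine mul_le_mul_of_nonneg_left ?_ (inv_pos.2 hI0).le
      rw [abs_mul, abs_mul, abs_of_nonneg (tau_nonneg hN _), abs_two]
      have hg := hG0 p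
      by_cases hp : p ∈ S
      · rw [Set.indicator_of_mem hp]
        have := mul_le_mul_of_nonneg_right (tau_le_one s1 s2 (1 / δ) (U p ^ 2))
          (show 0 ≤ 2 * |U p| * GU lam U p by positivity)
        linarith
      · rw [Set.indicator_of_notMem hp]
        have : tau s1 s2 (1 / δ) (U p ^ 2) = 0 := by
          by_cases h3 : s1 < U p ^ 2
          · have : s2 < U p ^ 2 := by
              by_contra h4
              exact hp ⟨h3, h4⟩
            exact tau_zero_right this.le
          · exact tau_zero_left (not_lt.1 h3)
        rw [this]; simp
    have e1 : ∫⁻ p, ENNReal.ofReal (GU lam V p) ∂cvM lam ≤ ENNReal.ofReal (I⁻¹ * J) := by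
      refine (lintegral_mono fun p => ENNReal.ofReal_le_ofReal (hGV p)).trans ?_
      rw [← ofReal_integral_eq_lintegral_ofReal ((iug.indicator hSm).const_mul _)
        (Eventually.of_forall fun p => ?_), integral_const_mul, integral_indicator hSm]
      refine mul_nonneg (inv_pos.2 hI0).le (Set.indicator_nonneg (fun x _ => ?_) p)
      have := hG0 x
      positivity
    have e2 : P ≤ I⁻¹ * J := by
      refine (ENNReal.ofReal_le_ofReal_iff (mul_nonneg (inv_pos.2 hI0).le hJ0)).1 (key.trans e1)
    have hP0 : 0 ≤ P := by
      rw [hP]; unfold pf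
      split_ifs <;> positivity
    have e3 : I * P ≤ J := by
      have := mul_le_mul_of_nonneg_left e2 hI0.le
      rwa [mul_inv_cancel_left₀ hI0.ne'] at this
    exact (mul_le_mul_of_nonneg_right hI hP0).trans e3
  have lim : Tendsto (fun δ : ℝ => (s2 - s1 - 2 * δ) * P) (𝓝[>] 0) (𝓝 ((s2 - s1 - 2 * 0) * P)) := by
    have : Continuous fun δ : ℝ => (s2 - s1 - 2 * δ) * P := by fun_prop
    exact (this.tendsto 0).mono_left nhdsWithin_le_nhds
  rw [mul_zero, sub_zero] at lim
  refine le_of_tendsto lim ?_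
  have : Set.Ioo (0 : ℝ) ((s2 - s1) / 2) ∈ 𝓝[>] (0 : ℝ) := Ioo_mem_nhdsGT (by linarith)
  filter_upwards [this] with δ hδ
  exact main δ hδ.1 (by linarith [hδ.2])

end PartE2


section PartF

open MeasureTheory
open scoped ENNReal

def catQ (p : ℝ × ℝ) : Catenoid := ((p.1 : AddCircle (2 * Real.pi)), p.2)

lemma catQ_open : IsOpenQuotientMap catQ := by
  have h := (QuotientAddGroup.isOpenQuotientMap_mk (G := ℝ)
    (N := AddSubgroup.zmultiples (2 * Real.pi))).prodMap (IsOpenQuotientMap.id (X := ℝ))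
  exact h

lemma catQ_continuous : Continuous catQ := catQ_open.continuous

lemma catQ_mp0 : MeasurePreserving catQ nuM volume := by
  have h1 := AddCircle.measurePreserving_mk (2 * Real.pi) (-π)
  have e : volume.restrict (Set.Ioc (-π) (-π + 2 * π)) = volume.restrict (Set.Ioo (-π) π) := by
    rw [show -π + 2 * π = π by ring]
    exact (Measure.restrict_congr_set Ioo_ae_eq_Ioc).symm
  rw [e] at h1
  have h := h1.prod (MeasurePreserving.id (volume : Measure ℝ))
  exact h

lemma catQ_mp (lam : ℝ) : MeasurePreserving catQ (cvM lam) (catVol lam) := by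
  refine ⟨catQ_continuous.measurable, ?_⟩
  have hm : Measurable fun x : Catenoid => ENNReal.ofReal (Real.sqrt (x.2 ^ 2 + lam ^ 2)) := by
    fun_prop
  ext s hs
  rw [Measure.map_apply catQ_continuous.measurable hs]
  unfold cvM catVol
  rw [withDensity_apply _ (catQ_continuous.measurable hs), withDensity_apply _ hs,
    ← catQ_mp0.setLIntegral_comp_preimage hs hm]
  rfl

lemma catLift_eq (u : Catenoid → ℝ) : catLift u = u ∘ catQ := rfl

lemma catLift_add_int (u : Catenoid → ℝ) (k : ℤ) (p : ℝ × ℝ) :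
    catLift u (p + ((k : ℝ) * (2 * π), 0)) = catLift u p := by
  unfold catLift
  have : (((p + ((k : ℝ) * (2 * π), 0)).1 : ℝ) : AddCircle (2 * Real.pi)) = (p.1 : AddCircle (2 * Real.pi)) := by
    rw [QuotientAddGroup.eq_iff_sub_mem, AddSubgroup.mem_zmultiples_iff]
    exact ⟨k, by simp⟩
  rw [this]
  simp

lemma catGradSq_catQ {lam : ℝ} (u : Catenoid → ℝ) (p : ℝ × ℝ) :
    catGradSq lam u (catQ p) = GU lam (catLift u) p ^ 2 := by
  have hk : ∃ k : ℤ, catRep (catQ p) = p + ((k : ℝ) * (2 * π), 0) := by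
    have h : (((AddCircle.equivIco (2 * Real.pi) 0 (p.1 : AddCircle (2 * Real.pi)) : ℝ)) :
        AddCircle (2 * Real.pi)) = (p.1 : AddCircle (2 * Real.pi)) := AddCircle.coe_equivIco
    rw [QuotientAddGroup.eq_iff_sub_mem, AddSubgroup.mem_zmultiples_iff] at h
    obtain ⟨k, hk⟩ := h
    refine ⟨k, ?_⟩
    rw [zsmul_eq_mul] at hk
    unfold catRep catQ
    refine Prod.ext ?_ ?_
    · simp only [Prod.fst_add]
      linarith
    · simp
  obtain ⟨k, hk⟩ := hk
  have hf : fderiv ℝ (catLift u) (catRep (catQ p)) = fderiv ℝ (catLift u) p := by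
    rw [hk, ← fderiv_comp_add_right]
    congr 1
    funext x
    exact catLift_add_int u k x
  unfold catGradSq GU
  rw [hf, Real.sq_sqrt (by positivity)]
  rfl

lemma catSmooth_continuous {u : Catenoid → ℝ} (hu : CatSmooth u) : Continuous u := by
  have h : Continuous (u ∘ catQ) := hu.continuous
  exact catQ_open.isQuotientMap.continuous_iff.2 h

lemma catVol_rayleigh {lam : ℝ} (hl : 0 < lam) {u : Catenoid → ℝ} (hu : CatSmooth u) :
    (∫ x, (u x) ^ 2 ∂catVol lam) = ∫ p, catLift u p ^ 2 ∂cvM lam ∧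
    (∫ x, catGradSq lam u x ∂catVol lam) = ∫ p, GU lam (catLift u) p ^ 2 ∂cvM lam := by
  have hU : ContDiff ℝ 1 (catLift u) := hu.of_le (by exact_mod_cast le_top)
  have hq := catQ_mp lam
  constructor
  · rw [← hq.map_eq]
    exact integral_map (f := fun x => u x ^ 2) hq.measurable.aemeasurable
      ((catSmooth_continuous hu).pow 2).aestronglyMeasurable
  · have hc : Continuous (catGradSq lam u) := by
      refine catQ_open.isQuotientMap.continuous_iff.2 ?_
      have : catGradSq lam u ∘ catQ = fun p => GU lam (catLift u) p ^ 2 :=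
        funext fun p => catGradSq_catQ u p
      rw [this]
      exact (GU_continuous hl hU).pow 2
    rw [← hq.map_eq, integral_map hq.measurable.aemeasurable hc.aestronglyMeasurable]
    exact integral_congr_ae (Eventually.of_forall fun p => catGradSq_catQ u p)

/-- the part of the data of a test function used in the lifted inequality -/
lemma compact_data {u : Catenoid → ℝ} (hu : CatSmooth u) (hcs : HasCompactSupport u) :
    ∃ T M : ℝ, (∀ x : Catenoid, T ≤ |x.2| → u x = 0) ∧ ∀ x, u x ^ 2 ≤ M := by
  obtain ⟨C, hC⟩ := (catSmooth_continuous hu).bounded_above_of_compact_support hcs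
  have hb : ∃ R : ℝ, ∀ x ∈ tsupport u, |x.2| ≤ R := by
    obtain ⟨R, hR⟩ := hcs.isCompact.exists_bound_of_continuousOn (f := fun x : Catenoid => x.2)
      continuous_snd.continuousOn
    exact ⟨R, hR⟩
  obtain ⟨R, hR⟩ := hb
  refine ⟨R + 1, C ^ 2, ?_, ?_⟩
  · intro x hx
    by_contra hne
    have := hR x (subset_tsupport u hne)
    linarith
  · intro x
    have := hC x
    rw [Real.norm_eq_abs] at this
    rw [← sq_abs]
    exact pow_le_pow_left₀ (abs_nonneg _) this 2

def angCos (x : AddCircle (2 * Real.pi)) : ℝ := Real.Angle.cos x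

lemma angCos_coe (θ : ℝ) : angCos (θ : AddCircle (2 * Real.pi)) = Real.cos θ :=
  Real.Angle.cos_coe θ

lemma angCos_continuous : Continuous angCos := Real.Angle.continuous_cos

/-- a smooth squared pseudo-distance to `catQ (a, b)` -/
def dd (a b : ℝ) (x : Catenoid) : ℝ := 2 - 2 * angCos (x.1 - (a : AddCircle (2 * Real.pi))) + (x.2 - b) ^ 2

lemma dd_continuous (a b : ℝ) : Continuous (dd a b) := by
  have := angCos_continuous
  unfold dd; fun_prop

lemma dd_catQ (a b : ℝ) (p : ℝ × ℝ) : dd a b (catQ p) = 2 - 2 * Real.cos (p.1 - a) + (p.2 - b) ^ 2 := by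
  unfold dd catQ
  rw [← AddCircle.coe_sub, angCos_coe]

lemma dd_nonneg (a b : ℝ) (x : Catenoid) : 0 ≤ dd a b x := by
  obtain ⟨p, rfl⟩ := catQ_open.surjective x
  rw [dd_catQ]
  nlinarith [Real.cos_le_one (p.1 - a), sq_nonneg (p.2 - b)]

lemma dd_sq_le (a b : ℝ) (x : Catenoid) : (x.2 - b) ^ 2 ≤ dd a b x := by
  obtain ⟨p, rfl⟩ := catQ_open.surjective x
  rw [dd_catQ]
  have : (catQ p).2 = p.2 := rfl
  rw [this]
  nlinarith [Real.cos_le_one (p.1 - a)]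

lemma dd_eq_zero {a b : ℝ} {x : Catenoid} (h : dd a b x = 0) : x = catQ (a, b) := by
  obtain ⟨p, rfl⟩ := catQ_open.surjective x
  rw [dd_catQ] at h
  have h1 := Real.cos_le_one (p.1 - a)
  have h2 := sq_nonneg (p.2 - b)
  have h3 : Real.cos (p.1 - a) = 1 := by linarith
  have h4 : (p.2 - b) ^ 2 = 0 := by linarith
  have h5 : p.2 = b := by
    have := pow_eq_zero_iff (two_ne_zero) |>.1 h4
    linarith
  obtain ⟨k, hk⟩ := (Real.cos_eq_one_iff _).1 h3
  unfold catQ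
  refine Prod.ext ?_ h5
  change ((p.1 : ℝ) : AddCircle (2 * Real.pi)) = (a : AddCircle (2 * Real.pi))
  rw [QuotientAddGroup.eq_iff_sub_mem, AddSubgroup.mem_zmultiples_iff]
  exact ⟨k, by rw [zsmul_eq_mul, hk]⟩

lemma dd_compact (a b r : ℝ) : IsCompact {x | dd a b x ≤ r} := by
  have hK : IsCompact ((Set.univ : Set (AddCircle (2 * Real.pi))) ×ˢ Set.Icc (b - (|r| + 1)) (b + (|r| + 1))) :=
    isCompact_univ.prod isCompact_Icc
  refine hK.of_isClosed_subset (isClosed_le (dd_continuous a b) continuous_const) ?_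
  intro x hx
  refine ⟨trivial, ?_⟩
  have h1 := (dd_sq_le a b x).trans hx
  have h2 := le_abs_self r
  have h3 : |x.2 - b| ≤ |r| + 1 := by
    refine abs_le_of_sq_le_sq ?_ (by positivity)
    nlinarith [abs_nonneg r]
  have := abs_le.1 h3
  exact ⟨by linarith, by linarith⟩

lemma exists_test {lam : ℝ} (hl : 0 < lam) {Ω : Set Catenoid} (hΩ : IsOpen Ω) (hne : Ω.Nonempty) :
    ∃ u : Catenoid → ℝ, CatSmooth u ∧ HasCompactSupport u ∧ tsupport u ⊆ Ω ∧
    (∫ x, (u x) ^ 2 ∂catVol lam) ≠ 0 := by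
  obtain ⟨x0, hx0⟩ := hne
  obtain ⟨⟨a, b⟩, rfl⟩ := catQ_open.surjective x0
  have hε : ∃ ε, 0 < ε ∧ {x | dd a b x ≤ ε} ⊆ Ω := by
    have hK : IsCompact ({x | dd a b x ≤ 1} \ Ω) := (dd_compact a b 1).diff hΩ
    rcases Set.eq_empty_or_nonempty ({x | dd a b x ≤ 1} \ Ω) with he | hne
    · refine ⟨1, one_pos, ?_⟩
      intro x hx
      by_contra hxΩ
      have : x ∈ ({x | dd a b x ≤ 1} \ Ω) := ⟨hx, hxΩ⟩
      rw [he] at this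
      exact this
    · obtain ⟨y, hy, hmin⟩ := hK.exists_isMinOn hne (dd_continuous a b).continuousOn
      have hpos : 0 < dd a b y := by
        refine lt_of_le_of_ne (dd_nonneg a b y) fun h0 => hy.2 ?_
        rw [dd_eq_zero h0.symm]
        exact hx0
      refine ⟨dd a b y / 2, by positivity, ?_⟩
      intro x hx
      have hx' : dd a b x ≤ dd a b y / 2 := hx
      by_contra hxΩ
      have hy1 : dd a b y ≤ 1 := hy.1
      have := hmin (show x ∈ ({x | dd a b x ≤ 1} \ Ω) from ⟨show dd a b x ≤ 1 by linarith, hxΩ⟩)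
      have : dd a b y ≤ dd a b x := this
      linarith
  obtain ⟨ε, hε0, hεΩ⟩ := hε
  let u : Catenoid → ℝ := fun x => Real.smoothTransition (1 - dd a b x / ε)
  have hsub : Function.support u ⊆ {x | dd a b x ≤ ε} := by
    intro x hx
    by_contra hcon
    refine hx (Real.smoothTransition.zero_of_nonpos ?_)
    have : ε < dd a b x := not_le.1 hcon
    have : 1 ≤ dd a b x / ε := by rw [le_div_iff₀ hε0]; linarith
    linarith
  have hts : tsupport u ⊆ {x | dd a b x ≤ ε} :=
    closure_minimal hsub (isClosed_le (dd_continuous a b) continuous_const)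
  have hcs : HasCompactSupport u := (dd_compact a b ε).of_isClosed_subset (isClosed_tsupport u) hts
  have hsm : CatSmooth u := by
    unfold CatSmooth
    have e : catLift u = fun p : ℝ × ℝ =>
        Real.smoothTransition (1 - (2 - 2 * Real.cos (p.1 - a) + (p.2 - b) ^ 2) / ε) := by
      funext p
      rw [← dd_catQ]
      rfl
    rw [e]
    refine Real.smoothTransition.contDiff.comp ?_
    refine contDiff_const.sub (ContDiff.div_const ?_ _)
    refine (contDiff_const.sub (contDiff_const.mul (Real.contDiff_cos.comp (contDiff_fst.sub contDiff_const)))).add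
      ((contDiff_snd.sub contDiff_const).pow 2)
  refine ⟨u, hsm, hcs, hts.trans hεΩ, ?_⟩
  have huc := catSmooth_continuous hsm
  obtain ⟨T, M, hT, hM⟩ := compact_data hsm hcs
  have hInt2 : Integrable (fun x => u x ^ 2) (catVol lam) := by
    rw [← (catQ_mp lam).map_eq]
    refine (integrable_map_measure (huc.pow 2).aestronglyMeasurable (catQ_mp lam).measurable.aemeasurable).2 ?_
    refine cvM_integrable hl ((huc.pow 2).comp catQ_continuous) (T := T) ?_
    intro p hp
    have : u (catQ p) = 0 := hT (catQ p) hp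
    simp [this]
  refine ne_of_gt ((integral_pos_iff_support_of_nonneg (fun x => sq_nonneg _) hInt2).2 ?_)
  have hsupp : IsOpen (Function.support fun x => u x ^ 2) := (huc.pow 2).isOpen_support
  have hnon : (Function.support fun x => u x ^ 2).Nonempty := by
    refine ⟨catQ (a, b), ?_⟩
    have : u (catQ (a, b)) = 1 := by
      simp only [u]
      rw [dd_catQ]
      simp
    simp [this]
  have hv := hsupp.measure_pos (volume : Measure Catenoid) hnon
  have hac : (volume : Measure Catenoid) ≪ catVol lam := by
    refine withDensity_absolutelyContinuous' (by fun_prop) (Eventually.of_forall fun x => ?_)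
    have : 0 < Real.sqrt (x.2 ^ 2 + lam ^ 2) := Real.sqrt_pos.2 (by positivity)
    simpa using this
  rw [pos_iff_ne_zero]
  intro h0
  exact hv.ne' (hac h0)

lemma catLam1_gt {lam : ℝ} (hlam : 0 < lam) {m : ℝ} (hm : 0 < m) {Ω : Set Catenoid} (hΩ : IsOpen Ω)
    (hvol : catVol lam Ω = ENNReal.ofReal m) : π * y0 / m < catLam1 lam Ω := by
  have hne : Ω.Nonempty := by
    rcases Set.eq_empty_or_nonempty Ω with he | h
    · rw [he, measure_empty] at hvol
      have := ENNReal.ofReal_pos.2 hm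
      rw [← hvol] at this
      exact absurd this (lt_irrefl _)
    · exact h
  have hvol' : cvM lam (catQ ⁻¹' Ω) = ENNReal.ofReal m := by
    rw [(catQ_mp lam).measure_preimage hΩ.measurableSet.nullMeasurableSet, hvol]
  obtain ⟨κ, hκ, key⟩ := lifted_FK hlam hm (hΩ.preimage catQ_continuous).measurableSet hvol'
  refine hκ.trans_le ?_
  refine le_csInf ?_ ?_
  · obtain ⟨u, h1, h2, h3, h4⟩ := exists_test hlam hΩ hne
    exact ⟨_, u, h1, h2, h3, h4, rfl⟩
  · rintro c ⟨u, h1, h2, h3, h4, rfl⟩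
    obtain ⟨e1, e2⟩ := catVol_rayleigh hlam h1
    obtain ⟨T, M, hT, hM⟩ := compact_data h1 h2
    have hU : ContDiff ℝ 1 (catLift u) := h1.of_le (by exact_mod_cast le_top)
    have k := key (catLift u) hU
      (fun θ t => by
        have := catLift_add_int u 1 (θ, t)
        simpa using this)
      T (fun p hp => hT (catQ p) hp) ⟨M, fun p => hM (catQ p)⟩
      (fun p hp => h3 (subset_tsupport u hp))
    have hpos : 0 < ∫ x, (u x) ^ 2 ∂catVol lam :=
      lt_of_le_of_ne (integral_nonneg fun x => sq_nonneg _) (Ne.symm h4)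
    rw [le_div_iff₀ hpos, e1, e2]
    exact k

end PartF

/-- **Strict Faber–Krahn comparison on the catenoid (Proposition 3.5).**
Let `M` be the minimal catenoid in `ℝ³` with its induced metric. For every `m > 0` and
every regular (smooth) open set `Ω ⊆ M` with `Vol_g(Ω) = m`, one has the strict
inequality `λ₁(Ω) > λ₁(B_m)`, where `B_m` is a Euclidean disk of area `m`. -/
theorem catenoid_strict_faberKrahn (lam : ℝ) (hlam : 0 < lam) (m : ℝ) (hm : 0 < m)
    (Ω : Set Catenoid) (hΩ : IsOpen Ω) (hvol : catVol lam Ω = ENNReal.ofReal m) :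
    diskLam1 m < catLam1 lam Ω := by
  exact (diskLam1_le hm).trans_lt (catLam1_gt hlam hm hΩ hvol)

end
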